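/- Let d ≥ 1 be an integer and 0 < c < d a real number. Let p(x) = α_d x^d + ... + α_1 x be a real polynomial of degree d with α_d > 0, and let r be a C^∞ function on [x_0, ∞) for some x_0 ≥ 1 such that for every ε > 0 and every integer j ≥ 0 there are positive constants A_{j,ε}, B_{j,ε} and a point beyond which A_{j,ε} x^{c−j−ε} ≤ |r^{(j)}(x)| ≤ B_{j,ε} x^{c−j+ε}. Put f = p + r. Then the sequence (⌊f(n)⌋)_{n} (defined for integers n ≥ x_0) is an asymptotic basis. -/

import Mathlib

open Finset

noncomputable def ee (x : ℝ) : ℂ := Complex.exp (Complex.I * ((2 * Real.pi * x : ℝ) : ℂ))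

lemma ee_add (x y : ℝ) : ee (x + y) = ee x * ee y := by
  unfold ee; rw [← Complex.exp_add]; congr 1; push_cast; ring

lemma ee_norm (x : ℝ) : ‖ee x‖ = 1 := by
  unfold ee; exact Complex.norm_exp_I_mul_ofReal _

lemma ee_zero : ee 0 = 1 := by simp [ee]

lemma ee_ne (x : ℝ) : ee x ≠ 0 := Complex.exp_ne_zero _

lemma ee_conj (x : ℝ) : (starRingEnd ℂ) (ee x) = ee (-x) := by
  unfold ee; rw [← Complex.exp_conj]; congr 1
  rw [map_mul, Complex.conj_I, Complex.conj_ofReal]; push_cast; ring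

lemma ee_sub (x y : ℝ) : ee (x - y) = ee x * (starRingEnd ℂ) (ee y) := by
  rw [ee_conj, ← ee_add, sub_eq_add_neg]

lemma ee_re (x : ℝ) : (ee x).re = Real.cos (2 * Real.pi * x) := by
  unfold ee; rw [mul_comm, Complex.exp_ofReal_mul_I_re]

lemma ee_im (x : ℝ) : (ee x).im = Real.sin (2 * Real.pi * x) := by
  unfold ee; rw [mul_comm, Complex.exp_ofReal_mul_I_im]

lemma ee_sub_one_lower (x : ℝ) (hx : |x| ≤ 1 / 2) : 4 * |x| ≤ ‖ee x - 1‖ := by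
  unfold ee
  rw [Complex.norm_exp_I_mul_ofReal_sub_one]
  have hpi := Real.pi_pos
  have h := @Real.mul_abs_le_abs_sin (2 * Real.pi * x / 2) (by
    rw [show 2 * Real.pi * x / 2 = Real.pi * x by ring, abs_mul, abs_of_pos hpi]; nlinarith)
  rw [norm_mul, Real.norm_eq_abs, Real.norm_eq_abs, abs_of_pos (by norm_num : (0:ℝ) < 2)]
  have : 2 / Real.pi * |2 * Real.pi * x / 2| = 2 * |x| := by
    rw [show 2 * Real.pi * x / 2 = Real.pi * x by ring, abs_mul, abs_of_pos hpi]; field_simp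
  linarith

lemma ee_lip (x y : ℝ) : ‖ee x - ee y‖ ≤ 8 * |x - y| := by
  have : ee x - ee y = ee y * (ee (x - y) - 1) := by
    rw [mul_sub, ← ee_add, mul_one]; congr 2; ring
  rw [this, norm_mul, ee_norm, one_mul]
  unfold ee
  refine (Real.norm_exp_I_mul_ofReal_sub_one_le).trans ?_
  rw [Real.norm_eq_abs, abs_mul, abs_of_pos (by positivity)]
  have := Real.pi_lt_four
  nlinarith [abs_nonneg (x - y)]

/-- Kusmin–Landau type bound. -/
lemma kusmin (φ : ℕ → ℝ) (N : ℕ) (l μ : ℝ) (hl : 0 < l)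
    (h1 : ∀ n ≤ N, l ≤ |φ (n + 1) - φ n|) (h1' : ∀ n ≤ N, |φ (n + 1) - φ n| ≤ 1 / 2)
    (h2 : ∀ n ≤ N, |(φ (n + 2) - φ (n + 1)) - (φ (n + 1) - φ n)| ≤ μ) :
    ‖∑ n ∈ range N, ee (φ n)‖ ≤ 1 / l + N * μ / l ^ 2 := by
  set w : ℕ → ℂ := fun n => (ee (φ (n + 1) - φ n) - 1)⁻¹ with hw
  have hlow : ∀ n ≤ N, 4 * l ≤ ‖ee (φ (n + 1) - φ n) - 1‖ := fun n hn =>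
    (by linarith [h1 n hn] : 4 * l ≤ 4 * |φ (n + 1) - φ n|).trans (ee_sub_one_lower _ (h1' n hn))
  have hne : ∀ n ≤ N, ee (φ (n + 1) - φ n) - 1 ≠ 0 := fun n hn h => by
    have := hlow n hn; rw [h, norm_zero] at this; linarith
  have hwn : ∀ n ≤ N, ‖w n‖ ≤ 1 / (4 * l) := fun n hn => by
    simp only [hw, norm_inv]
    rw [one_div]; exact inv_anti₀ (by positivity) (hlow n hn)
  have key : ∀ m ≤ N, ‖∑ n ∈ range m, ee (φ n) - w m * ee (φ m)‖ ≤ 1 / (4 * l) + m * (μ / (2 * l ^ 2)) := by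
    intro m
    induction m with
    | zero =>
      intro hm
      simp only [range_zero, sum_empty, zero_sub, norm_neg, norm_mul, ee_norm, mul_one]
      have := hwn 0 hm
      push_cast; linarith
    | succ m ih =>
      intro hm
      have ih := ih (by omega)
      have e1 : ee (φ m) = w m * ee (φ (m + 1)) - w m * ee (φ m) := by
        have : ee (φ (m + 1)) = ee (φ (m + 1) - φ m) * ee (φ m) := by
          rw [← ee_add]; congr 1; ring
        rw [this]
        have h := hne m (by omega)
        simp only [hw]
        field_simp
      have e2 : ∑ n ∈ range (m + 1), ee (φ n) - w (m + 1) * ee (φ (m + 1))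
          = (∑ n ∈ range m, ee (φ n) - w m * ee (φ m)) + (w m - w (m + 1)) * ee (φ (m + 1)) := by
        rw [sum_range_succ]
        linear_combination e1
      have e3 : ‖w m - w (m + 1)‖ ≤ μ / (2 * l ^ 2) := by
        have hm0 := hne m (by omega)
        have hm1 := hne (m + 1) hm
        have : w m - w (m + 1) = (ee (φ (m + 1 + 1) - φ (m + 1)) - ee (φ (m + 1) - φ m)) * (w m * w (m + 1)) := by
          simp only [hw]; field_simp; ring
        rw [this, norm_mul, norm_mul]
        have a1 := ee_lip (φ (m + 1 + 1) - φ (m + 1)) (φ (m + 1) - φ m)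
        have a2 := h2 m (by omega)
        have a3 := hwn m (by omega)
        have a4 := hwn (m + 1) hm
        have : ‖ee (φ (m + 1 + 1) - φ (m + 1)) - ee (φ (m + 1) - φ m)‖ ≤ 8 * μ := by
          refine a1.trans ?_
          gcongr
        calc _ ≤ (8 * μ) * (1 / (4 * l) * (1 / (4 * l))) := by
              gcongr
              exact (norm_nonneg _).trans this
          _ = _ := by field_simp; ring
      rw [e2]
      refine (norm_add_le _ _).trans ?_
      rw [norm_mul, ee_norm, mul_one]
      push_cast
      linarith
  have hk := key N le_rfl
  have hμ : 0 ≤ μ := (abs_nonneg _).trans (h2 0 (Nat.zero_le _))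
  have : ‖∑ n ∈ range N, ee (φ n)‖ ≤ ‖∑ n ∈ range N, ee (φ n) - w N * ee (φ N)‖ + ‖w N * ee (φ N)‖ := by
    have := norm_add_le (∑ n ∈ range N, ee (φ n) - w N * ee (φ N)) (w N * ee (φ N))
    simpa using this
  rw [norm_mul, ee_norm, mul_one] at this
  have h3 := hwn N le_rfl
  have e4 : 1 / (4 * l) ≤ 1 / (2 * l) := by gcongr; norm_num
  have e5 : (N : ℝ) * (μ / (2 * l ^ 2)) ≤ N * μ / l ^ 2 := by
    rw [mul_div_assoc]; gcongr; nlinarith [sq_nonneg l]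
  have e6 : 1 / (4 * l) + 1 / (4 * l) = 1 / (2 * l) := by field_simp; norm_num
  have e7 : 1 / (2 * l) ≤ 1 / l := by gcongr; linarith
  linarith

lemma shift_sum (z : ℕ → ℂ) (hz : ∀ n, ‖z n‖ ≤ 1) (N t : ℕ) :
    ‖∑ n ∈ range N, z (n + t) - ∑ n ∈ range N, z n‖ ≤ 2 * t := by
  induction t with
  | zero => simp
  | succ t ih =>
    have h1 := sum_range_succ (fun n => z (n + t)) N
    have h2 := sum_range_succ' (fun n => z (n + t)) N
    have h3 : ∑ n ∈ range N, z (n + (t + 1)) = ∑ n ∈ range N, z (n + t) + (z (N + t) - z (0 + t)) := by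
      have : ∑ n ∈ range N, z (n + (t + 1)) = ∑ n ∈ range N, z (n + 1 + t) := by
        refine sum_congr rfl fun n _ => ?_
        congr 1; ring
      rw [this]; linear_combination h1 - h2
    rw [h3]
    have : ∑ n ∈ range N, z (n + t) + (z (N + t) - z (0 + t)) - ∑ n ∈ range N, z n
      = (∑ n ∈ range N, z (n + t) - ∑ n ∈ range N, z n) + (z (N + t) - z (0 + t)) := by ring
    rw [this]
    refine (norm_add_le _ _).trans ?_
    have h4 := norm_sub_le (z (N + t)) (z (0 + t))
    have := hz (N + t); have := hz (0 + t)
    push_cast; linarith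

/-- van der Corput inequality with spaced shifts. -/
lemma vdc (z : ℕ → ℂ) (hz : ∀ n, ‖z n‖ ≤ 1) (N q K : ℕ) (hK : 1 ≤ K) (hqK : q * K ^ 2 ≤ N)
    (B : ℝ) (hB0 : 0 ≤ B)
    (hB : ∀ j, 1 ≤ j → j < K → ‖∑ n ∈ range N, z (n + q * j) * (starRingEnd ℂ) (z n)‖ ≤ B) :
    ‖∑ n ∈ range N, z n‖ ^ 2 ≤ 14 * (N : ℝ) ^ 2 / K + 2 * N * B := by
  set S := ∑ n ∈ range N, z n with hS
  have hqKr : (q : ℝ) * K ^ 2 ≤ N := by exact_mod_cast hqK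
  have hK' : (1 : ℝ) ≤ K := by exact_mod_cast hK
  set W := ∑ n ∈ range N, ∑ t ∈ range K, z (n + q * t) with hW
  have h1 : ‖W - K * S‖ ≤ 2 * q * K ^ 2 := by
    have : W - K * S = ∑ t ∈ range K, (∑ n ∈ range N, z (n + q * t) - S) := by
      rw [hW, sum_comm, sum_sub_distrib]; simp
    rw [this]
    refine (norm_sum_le _ _).trans ?_
    refine (sum_le_card_nsmul _ _ (2 * q * K : ℝ) ?_).trans ?_
    · intro t ht
      refine (shift_sum z hz N (q * t)).trans ?_
      have : (t : ℝ) ≤ K := by exact_mod_cast (mem_range.1 ht).le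
      push_cast
      have : (q : ℝ) * t ≤ q * K := by gcongr
      linarith
    · simp; apply le_of_eq; ring
  have h2 : ‖W‖ ^ 2 ≤ N * ∑ n ∈ range N, ‖∑ t ∈ range K, z (n + q * t)‖ ^ 2 := by
    have a : ‖W‖ ≤ ∑ n ∈ range N, ‖∑ t ∈ range K, z (n + q * t)‖ := norm_sum_le _ _
    have b := sq_sum_le_card_mul_sum_sq (s := range N) (f := fun n => ‖∑ t ∈ range K, z (n + q * t)‖)
    rw [card_range] at b
    refine le_trans ?_ b
    gcongr
  have corr : ∀ t' t, t' < t → t < K →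
      ‖∑ n ∈ range N, z (n + q * t) * (starRingEnd ℂ) (z (n + q * t'))‖ ≤ B + 2 * q * K := by
    intro t' t htt ht
    have a := hB (t - t') (by omega) (by omega)
    have b := shift_sum (fun n => z (n + q * (t - t')) * (starRingEnd ℂ) (z n)) (by
      intro n
      rw [norm_mul, RCLike.norm_conj]
      exact mul_le_one₀ (hz _) (norm_nonneg _) (hz _)) N (q * t')
    have e : ∀ n, n + q * t' + q * (t - t') = n + q * t := by
      intro n
      obtain ⟨s, rfl⟩ := Nat.exists_eq_add_of_lt htt
      rw [show t' + s + 1 - t' = s + 1 by omega]; ring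
    simp only [e] at b
    have c : (t' : ℝ) ≤ K := by exact_mod_cast (by omega : t' ≤ K)
    have d := norm_add_le (∑ n ∈ range N, z (n + q * t) * (starRingEnd ℂ) (z (n + q * t')) - ∑ n ∈ range N, z (n + q * (t - t')) * (starRingEnd ℂ) (z n)) (∑ n ∈ range N, z (n + q * (t - t')) * (starRingEnd ℂ) (z n))
    rw [sub_add_cancel] at d
    push_cast at b
    have : (q : ℝ) * t' ≤ q * K := by gcongr
    linarith
  have h3 : (∑ n ∈ range N, ‖∑ t ∈ range K, z (n + q * t)‖ ^ 2 : ℝ)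
      ≤ ∑ t ∈ range K, ∑ t' ∈ range K, ‖∑ n ∈ range N, z (n + q * t) * (starRingEnd ℂ) (z (n + q * t'))‖ := by
    have a : ((∑ n ∈ range N, ‖∑ t ∈ range K, z (n + q * t)‖ ^ 2 : ℝ) : ℂ)
      = ∑ t ∈ range K, ∑ t' ∈ range K, ∑ n ∈ range N, z (n + q * t) * (starRingEnd ℂ) (z (n + q * t')) := by
      push_cast
      have : ∀ n, ((‖∑ t ∈ range K, z (n + q * t)‖ : ℂ) ^ 2) = ∑ t ∈ range K, ∑ t' ∈ range K, z (n + q * t) * (starRingEnd ℂ) (z (n + q * t')) := by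
        intro n
        rw [← Complex.mul_conj', map_sum, sum_mul_sum]
      simp only [this]
      rw [sum_comm]
      refine sum_congr rfl fun t _ => ?_
      rw [sum_comm]
    have b : (∑ n ∈ range N, ‖∑ t ∈ range K, z (n + q * t)‖ ^ 2 : ℝ)
      = ‖((∑ n ∈ range N, ‖∑ t ∈ range K, z (n + q * t)‖ ^ 2 : ℝ) : ℂ)‖ := by
      rw [Complex.norm_real, Real.norm_of_nonneg]; positivity
    rw [b, a]
    refine (norm_sum_le _ _).trans (sum_le_sum fun t _ => norm_sum_le _ _)
  have h4 : ∀ t ∈ range K, ∑ t' ∈ range K, ‖∑ n ∈ range N, z (n + q * t) * (starRingEnd ℂ) (z (n + q * t'))‖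
      ≤ N + K * (B + 2 * q * K) := by
    intro t ht
    have : ∀ t' ∈ range K, ‖∑ n ∈ range N, z (n + q * t) * (starRingEnd ℂ) (z (n + q * t'))‖
        ≤ (if t' = t then (N : ℝ) else 0) + (B + 2 * q * K) := by
      intro t' ht'
      have hp : 0 ≤ B + 2 * q * K := by positivity
      rw [mem_range] at ht ht'
      rcases lt_trichotomy t' t with h | h | h
      · rw [if_neg h.ne, zero_add]; exact corr _ _ h ht
      · rw [if_pos h]
        have : ‖∑ n ∈ range N, z (n + q * t) * (starRingEnd ℂ) (z (n + q * t'))‖ ≤ N := by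
          refine (norm_sum_le _ _).trans ?_
          refine (sum_le_card_nsmul _ _ (1 : ℝ) ?_).trans ?_
          · intro n _
            rw [norm_mul, RCLike.norm_conj]
            exact mul_le_one₀ (hz _) (norm_nonneg _) (hz _)
          · simp
        linarith
      · rw [if_neg h.ne', zero_add]
        have := corr _ _ h ht'
        rw [← RCLike.norm_conj, map_sum] at this
        simpa [mul_comm] using this
    refine (sum_le_sum this).trans ?_
    rw [sum_add_distrib, sum_ite_eq', if_pos ht]
    simp only [sum_const, card_range, nsmul_eq_mul]
    exact le_rfl
  have h5 : ‖W‖ ^ 2 ≤ N * (K * (N + K * (B + 2 * q * K))) := by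
    refine h2.trans ?_
    gcongr
    refine h3.trans ((sum_le_sum h4).trans ?_)
    simp only [sum_const, card_range, nsmul_eq_mul]
    exact le_rfl
  have h6 : K * ‖S‖ ≤ ‖W‖ + 2 * q * K ^ 2 := by
    have := norm_sub_norm_le ((K : ℂ) * S) W
    rw [norm_mul, Complex.norm_natCast, norm_sub_rev] at this
    linarith
  have hq0 : (0 : ℝ) ≤ q := by positivity
  have h7 : (K * ‖S‖) ^ 2 ≤ 2 * ‖W‖ ^ 2 + 8 * (q * K ^ 2) ^ 2 := by
    have : (K * ‖S‖) ^ 2 ≤ (‖W‖ + 2 * q * K ^ 2) ^ 2 := by gcongr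
    nlinarith [sq_nonneg (‖W‖ - 2 * q * K ^ 2)]
  have h8 : ((q : ℝ) * K ^ 2) ^ 2 ≤ N * (q * K ^ 2) := by
    rw [sq]; gcongr
  have h9 : ‖S‖ ^ 2 ≤ (2 * (N * (K * (N + K * (B + 2 * q * K)))) + 8 * (N * (q * K ^ 2))) / K ^ 2 := by
    rw [le_div_iff₀ (by positivity)]
    nlinarith
  refine h9.trans ?_
  rw [div_le_iff₀ (by positivity)]
  have : (14 * (N : ℝ) ^ 2 / K + 2 * N * B) * K ^ 2 = 14 * N ^ 2 * K + 2 * N * B * K ^ 2 := by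
    field_simp
  rw [this]
  have i1 : (N : ℝ) * (q * K ^ 2) * K ≤ N * N * K := by gcongr
  have i2 : (N : ℝ) * (q * K ^ 2) ≤ N * (q * K ^ 2) * K := by
    apply le_mul_of_one_le_right (by positivity) hK'
  nlinarith

def dif : List ℕ → (ℕ → ℝ) → (ℕ → ℝ)
  | [], φ => φ
  | h :: t, φ => dif t (fun n => φ (n + h) - φ n)

lemma iter_vdc (k : ℕ) : ∃ C : ℝ, 0 < C ∧ ∀ (N q K : ℕ), 1 ≤ N → 1 ≤ K → q * K ^ 2 ≤ N → ∀ (β : ℝ), 0 ≤ β →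
    ∀ φ : ℕ → ℝ, (∀ h : List ℕ, h.length = k → (∀ x ∈ h, ∃ j, 1 ≤ j ∧ j < K ∧ x = q * j) →
      ‖∑ n ∈ range N, ee (dif h φ n)‖ ≤ N * β) →
    (‖∑ n ∈ range N, ee (φ n)‖ / N) ^ (2 ^ k) ≤ C * (1 / K + β) := by
  induction k with
  | zero =>
    refine ⟨1, one_pos, ?_⟩
    intro N q K hN hK hq β hβ φ h
    have := h [] rfl (by simp)
    simp only [dif] at this
    have hN' : (0 : ℝ) < N := by exact_mod_cast hN
    rw [pow_zero, pow_one, one_mul, div_le_iff₀ hN']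
    have : (0 : ℝ) ≤ 1 / K * N := by positivity
    nlinarith
  | succ k ih =>
    obtain ⟨C, hC, ih⟩ := ih
    refine ⟨28 ^ (2 ^ k) + 4 ^ (2 ^ k) * C, by positivity, ?_⟩
    intro N q K hN hK hq β hβ φ h
    have hN' : (0 : ℝ) < N := by exact_mod_cast hN
    have hK' : (1 : ℝ) ≤ K := by exact_mod_cast hK
    -- bound of the one-step differenced sums
    set b : ℝ := (C * (1 / K + β)) ^ (((2 ^ k : ℕ) : ℝ)⁻¹) with hb
    have hb0 : 0 ≤ b := by positivity
    have hbp : b ^ (2 ^ k) = C * (1 / K + β) := by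
      rw [hb]
      exact Real.rpow_inv_natCast_pow (by positivity) (by positivity)
    have step : ∀ j, 1 ≤ j → j < K → ‖∑ n ∈ range N, ee (φ (n + q * j)) * (starRingEnd ℂ) (ee (φ n))‖ ≤ N * b := by
      intro j hj hjK
      have a := ih N q K hN hK hq β hβ (fun n => φ (n + q * j) - φ n) (by
        intro hh hlen hmem
        have := h ((q * j) :: hh) (by simp [hlen]) (by
          intro x hx
          rcases List.mem_cons.1 hx with rfl | hx
          · exact ⟨j, hj, hjK, rfl⟩
          · exact hmem x hx)
        simpa only [dif] using this)
      rw [← hbp] at a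
      have a' := le_of_pow_le_pow_left₀ (by positivity) hb0 a
      rw [div_le_iff₀ hN'] at a'
      simp only [ee_sub] at a'
      linarith
    have v := vdc (fun n => ee (φ n)) (fun n => (ee_norm _).le) N q K hK hq (N * b) (by positivity) step
    have v2 : (‖∑ n ∈ range N, ee (φ n)‖ / N) ^ 2 ≤ 14 / K + 2 * b := by
      rw [div_pow, div_le_iff₀ (by positivity)]
      refine v.trans (le_of_eq ?_); field_simp
    rw [pow_succ' 2 k, pow_mul]
    have v3 : ((‖∑ n ∈ range N, ee (φ n)‖ / N) ^ 2) ^ 2 ^ k ≤ (14 / K + 2 * b) ^ 2 ^ k := by gcongr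
    refine v3.trans ?_
    have v4 : (14 / K + 2 * b) ^ 2 ^ k ≤ (28 / K) ^ 2 ^ k + (4 * b) ^ 2 ^ k := by
      rcases le_total (14 / (K : ℝ)) (2 * b) with hle | hle
      · have : (14 / K + 2 * b) ^ 2 ^ k ≤ (4 * b) ^ 2 ^ k := by gcongr; linarith
        have : (0 : ℝ) ≤ (28 / K) ^ 2 ^ k := by positivity
        linarith
      · have : (14 / K + 2 * b) ^ 2 ^ k ≤ (28 / K) ^ 2 ^ k := by
          gcongr
          have : (28 : ℝ) / K = 14 / K + 14 / K := by ring
          linarith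
        have : (0 : ℝ) ≤ (4 * b) ^ 2 ^ k := by positivity
        linarith
    refine v4.trans ?_
    rw [mul_pow 4 b, hbp, div_pow]
    have v5 : (28 : ℝ) ^ 2 ^ k / K ^ 2 ^ k ≤ 28 ^ 2 ^ k * (1 / K) := by
      rw [div_eq_mul_one_div]
      gcongr
      exact le_self_pow₀ hK' (by positivity)
    have : (0 : ℝ) ≤ 28 ^ 2 ^ k * β := by positivity
    nlinarith

open Finset

lemma dif_append (h t : List ℕ) (φ : ℕ → ℝ) : dif (h ++ t) φ = dif t (dif h φ) := by
  induction h generalizing φ with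
  | nil => rfl
  | cons a h ih => simp only [List.cons_append, dif, ih]

lemma mvt_aux (g g' : ℝ → ℝ) (x₀ x : ℝ) (hx : x₀ < x) (hg : ∀ y, x₀ < y → HasDerivAt g (g' y) y)
    (h : ℕ) : ∃ ξ, x ≤ ξ ∧ ξ ≤ x + h ∧ g (x + h) - g x = h * g' ξ := by
  rcases Nat.eq_zero_or_pos h with rfl | hh
  · exact ⟨x, le_rfl, by simp, by simp⟩
  have hh' : (0 : ℝ) < h := by exact_mod_cast hh
  obtain ⟨ξ, hξ, e⟩ := exists_hasDerivAt_eq_slope g g' (a := x) (b := x + h) (by linarith)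
    (fun y hy => (hg y (lt_of_lt_of_le hx hy.1)).continuousAt.continuousWithinAt)
    (fun y hy => hg y (hx.trans hy.1))
  refine ⟨ξ, hξ.1.le, hξ.2.le, ?_⟩
  rw [e, add_sub_cancel_left]; field_simp

lemma mvt_dif (h : List ℕ) : ∀ (G : ℕ → ℝ → ℝ) (x₀ a : ℝ), x₀ < a →
    (∀ j x, x₀ < x → HasDerivAt (G j) (G (j + 1) x) x) → ∀ n : ℕ,
    ∃ ξ, a + n ≤ ξ ∧ ξ ≤ a + n + (h.sum : ℕ) ∧
      dif h (fun n => G 0 (a + n)) n = (h.prod : ℕ) * G h.length ξ := by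
  induction h with
  | nil =>
    intro G x₀ a ha hG n
    exact ⟨a + n, le_rfl, by simp, by simp [dif]⟩
  | cons b h ih =>
    intro G x₀ a ha hG n
    obtain ⟨ξ, h1, h2, h3⟩ := ih (fun j x => G j (x + b) - G j x) x₀ a ha (by
      intro j x hx
      have hb : (0 : ℝ) ≤ b := by positivity
      have e1 := hG j (x + b) (by linarith)
      exact (e1.comp_add_const x b).sub (hG j x hx)) n
    have hn : (0 : ℝ) ≤ n := by positivity
    obtain ⟨ξ', h1', h2', h3'⟩ := mvt_aux (G h.length) (G (h.length + 1)) x₀ ξ (by linarith)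
      (hG h.length) b
    refine ⟨ξ', h1.trans h1', ?_, ?_⟩
    · rw [List.sum_cons, Nat.cast_add]; linarith
    · simp only [dif, List.prod_cons, List.length_cons]
      have : (fun n : ℕ => G 0 (a + ((n + b : ℕ) : ℝ)) - G 0 (a + n)) = fun n : ℕ => G 0 (a + n + b) - G 0 (a + n) := by
        funext n; push_cast; rw [add_assoc]
      rw [this, h3, h3', Nat.cast_mul]; ring

lemma list_bounds (q K : ℕ) (h : List ℕ) (hh : ∀ x ∈ h, ∃ j, 1 ≤ j ∧ j < K ∧ x = q * j) :
    q ^ h.length ≤ h.prod ∧ h.prod ≤ (q * K) ^ h.length ∧ h.sum ≤ h.length * (q * K) := by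
  induction h with
  | nil => simp
  | cons a h ih =>
    obtain ⟨i1, i2, i3⟩ := ih (fun x hx => hh x (List.mem_cons_of_mem _ hx))
    obtain ⟨j, hj1, hj2, rfl⟩ := hh a List.mem_cons_self
    have l1 : q ≤ q * j := Nat.le_mul_of_pos_right _ hj1
    have l2 : q * j ≤ q * K := Nat.mul_le_mul_left _ hj2.le
    refine ⟨?_, ?_, ?_⟩
    · simp only [List.length_cons, List.prod_cons, pow_succ']
      exact Nat.mul_le_mul l1 i1
    · simp only [List.length_cons, List.prod_cons, pow_succ']
      exact Nat.mul_le_mul l2 i2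
    · simp only [List.length_cons, List.sum_cons]
      nlinarith

lemma gen (k : ℕ) : ∃ C : ℝ, 0 < C ∧ ∀ (G : ℕ → ℝ → ℝ) (x₀ : ℝ),
    (∀ j x, x₀ < x → HasDerivAt (G j) (G (j + 1) x) x) → ∀ (X K q : ℕ) (D E : ℝ), x₀ < X → 2 ≤ K → 1 ≤ q →
    1 ≤ X →
    q * K ^ 2 ≤ X → 0 < D → 1 ≤ E → E ≤ K →
    (∀ x : ℝ, X ≤ x → x ≤ (k + 4) * X → D ≤ |G (k + 1) x| ∧ |G (k + 1) x| ≤ D * E ∧ |G (k + 2) x| ≤ D * E / X) →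
    (q : ℝ) ^ k * D * K ^ (k + 1) ≤ 1 / 2 → (K : ℝ) ^ (k + 2) ≤ X * q ^ k * D →
    (‖∑ n ∈ range X, ee (G 0 (X + n))‖ / X) ^ (2 ^ k) ≤ C / K := by
  obtain ⟨C, hC, H⟩ := iter_vdc k
  refine ⟨3 * C, by positivity, ?_⟩
  intro G x₀ hG X K q D E hX hK hq hX1 hqK hD hE1 hEK hb h1 h2
  have hK' : (2 : ℝ) ≤ K := by exact_mod_cast hK
  have hX' : (1 : ℝ) ≤ X := by exact_mod_cast hX1
  have hq' : (1 : ℝ) ≤ q := by exact_mod_cast hq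
  have := H X q K hX1 (by omega) hqK (2 / K) (by positivity) (fun n => G 0 (X + n)) ?_
  · refine this.trans (le_of_eq ?_)
    field_simp; norm_num
  intro h hlen hmem
  obtain ⟨b1, b2, b3⟩ := list_bounds q K h hmem
  rw [hlen] at b1 b2 b3
  set P : ℝ := ((h.prod : ℕ) : ℝ) with hP
  have c1 : (q : ℝ) ^ k ≤ P := by rw [hP]; exact_mod_cast b1
  have c2 : P ≤ (q : ℝ) ^ k * K ^ k := by rw [hP, ← mul_pow]; exact_mod_cast b2
  have c3 : ((h.sum : ℕ) : ℝ) ≤ k * X := by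
    have : h.sum ≤ k * X := b3.trans (Nat.mul_le_mul_left _ (by nlinarith))
    exact_mod_cast this
  have hP0 : 0 < P := lt_of_lt_of_le (by positivity) c1
  have d1 : ∀ n, n ≤ X → ∃ ξ : ℝ, X ≤ ξ ∧ ξ ≤ (k + 4) * X ∧
      dif h (fun n => G 0 (X + n)) (n + 1) - dif h (fun n => G 0 (X + n)) n = P * G (k + 1) ξ := by
    intro n hn
    obtain ⟨ξ, e1, e2, e3⟩ := mvt_dif (h ++ [1]) G x₀ X hX hG n
    rw [dif_append] at e3
    have hn' : (n : ℝ) ≤ X := by exact_mod_cast hn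
    have hn0 : (0 : ℝ) ≤ n := by positivity
    refine ⟨ξ, by linarith, ?_, ?_⟩
    · simp at e2 c3; nlinarith
    · simp [dif, hlen] at e3; rw [e3, hP]; push_cast; rfl
  have d2 : ∀ n, n ≤ X → ∃ ξ : ℝ, X ≤ ξ ∧ ξ ≤ (k + 4) * X ∧
      (dif h (fun n => G 0 (X + n)) (n + 2) - dif h (fun n => G 0 (X + n)) (n + 1)) -
        (dif h (fun n => G 0 (X + n)) (n + 1) - dif h (fun n => G 0 (X + n)) n) = P * G (k + 2) ξ := by
    intro n hn
    obtain ⟨ξ, e1, e2, e3⟩ := mvt_dif (h ++ [1, 1]) G x₀ X hX hG n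
    rw [dif_append] at e3
    have hn' : (n : ℝ) ≤ X := by exact_mod_cast hn
    have hn0 : (0 : ℝ) ≤ n := by positivity
    refine ⟨ξ, by linarith, ?_, ?_⟩
    · simp at e2 c3; nlinarith
    · simp [dif, hlen] at e3; rw [e3, hP]; push_cast; rfl
  have kl := kusmin (dif h (fun n => G 0 (X + n))) X (q ^ k * D) (q ^ k * K ^ k * (D * E / X)) (by positivity)
    (by
      intro n hn
      obtain ⟨ξ, e1, e2, e3⟩ := d1 n hn
      rw [e3, abs_mul, abs_of_pos hP0]
      have := (hb ξ e1 e2).1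
      gcongr)
    (by
      intro n hn
      obtain ⟨ξ, e1, e2, e3⟩ := d1 n hn
      rw [e3, abs_mul, abs_of_pos hP0]
      have := (hb ξ e1 e2).2.1
      calc P * |G (k + 1) ξ| ≤ (q ^ k * K ^ k) * (D * K) := by
            gcongr
            refine this.trans ?_
            gcongr
        _ = (q : ℝ) ^ k * D * K ^ (k + 1) := by ring
        _ ≤ _ := h1)
    (by
      intro n hn
      obtain ⟨ξ, e1, e2, e3⟩ := d2 n hn
      rw [e3, abs_mul, abs_of_pos hP0]
      have := (hb ξ e1 e2).2.2
      gcongr)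
  refine kl.trans ?_
  set Q : ℝ := (q : ℝ) ^ k with hQ
  have hQ0 : 0 < Q := by positivity
  have k1 : 1 / (Q * D) + X * (Q * K ^ k * (D * E / X)) / (Q * D) ^ 2 = (1 + K ^ k * E) / (Q * D) := by
    field_simp
  rw [k1, div_le_iff₀ (by positivity)]
  have k2 : (1 : ℝ) ≤ K ^ (k + 1) := one_le_pow₀ (by linarith)
  have k3 : (K : ℝ) ^ k * E ≤ K ^ (k + 1) := by rw [pow_succ]; gcongr
  have k4 : (X : ℝ) * (2 / K) * (Q * D) = 2 * (X * Q * D) / K := by ring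
  rw [k4, le_div_iff₀ (by positivity)]
  have k5 : (K : ℝ) ^ (k + 2) = K ^ (k + 1) * K := by ring
  nlinarith

lemma gen' (k : ℕ) : ∃ C : ℝ, 0 < C ∧ ∀ (G : ℕ → ℝ → ℝ) (x₀ : ℝ),
    (∀ j x, x₀ < x → HasDerivAt (G j) (G (j + 1) x) x) → ∀ (X K : ℕ) (D E : ℝ), x₀ < X → 2 ≤ K →
    0 < D → 1 ≤ E → E ≤ K →
    (∀ x : ℝ, X ≤ x → x ≤ (k + 4) * X → D ≤ |G (k + 1) x| ∧ |G (k + 1) x| ≤ D * E ∧ |G (k + 2) x| ≤ D * E / X) →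
    D * K ^ (k + 1) ≤ 1 / 2 → (2 : ℝ) ^ k * K ^ (3 * k + 2) ≤ X ^ (k + 1) * D →
    (2 : ℝ) ^ (k + 1) * K ^ (2 * k + 3) ≤ X →
    (‖∑ n ∈ range X, ee (G 0 (X + n))‖ / X) ^ (2 ^ k) ≤ C / K := by
  obtain ⟨C, hC, H⟩ := gen k
  refine ⟨C, hC, ?_⟩
  intro G x₀ hG X K D E hX hK hD hE1 hEK hb h1 h2 h3
  have hK' : (2 : ℝ) ≤ K := by exact_mod_cast hK
  have hK1 : (1 : ℝ) ≤ K := by linarith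
  have hKX : (K : ℝ) ^ 2 ≤ X := by
    refine le_trans ?_ h3
    calc (K : ℝ) ^ 2 ≤ 1 * K ^ (2 * k + 3) := by
          rw [one_mul]; exact pow_le_pow_right₀ hK1 (by omega)
      _ ≤ _ := by gcongr; exact one_le_pow₀ (by norm_num)
  have hKX' : K ^ 2 ≤ X := by exact_mod_cast hKX
  have hX1 : 1 ≤ X := le_trans (by nlinarith) hKX'
  classical
  set p : ℕ → Prop := fun q => q * K ^ 2 ≤ X ∧ (q : ℝ) ^ k * D * K ^ (k + 1) ≤ 1 / 2 with hp
  have p1 : p 1 := ⟨by omega, by simpa using h1⟩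
  set q := Nat.findGreatest p X with hq
  have hq1 : 1 ≤ q := Nat.le_findGreatest hX1 p1
  have hpq : p q := Nat.findGreatest_spec (m := 1) hX1 p1
  have hnp : ¬ p (q + 1) := by
    intro h
    have : q + 1 ≤ X := by
      have := h.1
      nlinarith [Nat.pos_of_ne_zero (by positivity : K ^ 2 ≠ 0)]
    have := Nat.le_findGreatest this h
    omega
  refine H G x₀ hG X K q D E hX hK hq1 hX1 hpq.1 hD hE1 hEK hb hpq.2 ?_
  have hq1' : (1 : ℝ) ≤ q := by exact_mod_cast hq1
  have hX1' : (1 : ℝ) ≤ X := by exact_mod_cast hX1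
  by_cases hc : (q + 1) * K ^ 2 ≤ X
  · have : ¬ (((q + 1 : ℕ) : ℝ) ^ k * D * K ^ (k + 1) ≤ 1 / 2) := fun h => hnp ⟨hc, h⟩
    push Not at this
    push_cast at this
    have e1 : ((q : ℝ) + 1) ^ k ≤ 2 ^ k * q ^ k := by
      rw [← mul_pow]; gcongr; linarith
    have e2 : (1 : ℝ) / 2 < 2 ^ k * q ^ k * D * K ^ (k + 1) := by
      refine this.trans_le ?_
      gcongr
    have e3 : (1 : ℝ) ≤ 2 ^ (k + 1) * K ^ (k + 1) * (q ^ k * D) := by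
      have : (2 : ℝ) ^ (k + 1) = 2 * 2 ^ k := by ring
      rw [this]; nlinarith
    have e4 : (2 : ℝ) ^ (k + 1) * K ^ (2 * k + 3) = (2 ^ (k + 1) * K ^ (k + 1)) * K ^ (k + 2) := by ring
    rw [e4] at h3
    have e5 : (0 : ℝ) < q ^ k * D := by positivity
    have e6 : (2 : ℝ) ^ (k + 1) * K ^ (k + 1) * K ^ (k + 2) * (q ^ k * D) ≤ X * (q ^ k * D) := by gcongr
    have e7 : 1 * (K : ℝ) ^ (k + 2) ≤ (2 ^ (k + 1) * K ^ (k + 1) * (q ^ k * D)) * K ^ (k + 2) := by gcongr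
    nlinarith
  · push Not at hc
    have hc' : (X : ℝ) ≤ (q + 1) * K ^ 2 := by exact_mod_cast hc.le
    have e1 : (X : ℝ) ≤ 2 * q * K ^ 2 := hc'.trans (by gcongr; linarith)
    have e2 : (X : ℝ) ^ k ≤ 2 ^ k * q ^ k * K ^ (2 * k) := by
      calc (X : ℝ) ^ k ≤ (2 * q * K ^ 2) ^ k := by gcongr
        _ = _ := by rw [mul_pow, mul_pow, ← pow_mul]
    have e3 : (2 : ℝ) ^ k * K ^ (3 * k + 2) ≤ X * (2 ^ k * q ^ k * K ^ (2 * k)) * D := by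
      refine h2.trans ?_
      rw [pow_succ, mul_comm ((X : ℝ) ^ k)]
      gcongr
    have e4 : (2 : ℝ) ^ k * K ^ (3 * k + 2) = (2 ^ k * K ^ (2 * k)) * K ^ (k + 2) := by ring
    have e5 : (X : ℝ) * (2 ^ k * q ^ k * K ^ (2 * k)) * D = (2 ^ k * K ^ (2 * k)) * (X * q ^ k * D) := by ring
    rw [e4, e5] at e3
    exact le_of_mul_le_mul_left e3 (by positivity)

open Finset Filter Topology

lemma poly_lim (Q : Polynomial ℝ) (m : ℕ) (hQ : Q.natDegree ≤ m) :
    Tendsto (fun x : ℝ => Q.eval x / x ^ m) atTop (𝓝 (Q.coeff m)) := by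
  have h : ∀ x : ℝ, Q.eval x / x ^ m = ∑ i ∈ range (m + 1), Q.coeff i * (x ^ i / x ^ m) := by
    intro x
    rw [Polynomial.eval_eq_sum_range' (Nat.lt_succ_of_le hQ), sum_div]
    exact sum_congr rfl fun i _ => mul_div_assoc _ _ _
  simp only [h]
  have e : Q.coeff m = ∑ i ∈ range (m + 1), Q.coeff i * (if i = m then 1 else 0) := by
    simp
  rw [e]
  refine tendsto_finsetSum _ fun i hi => Tendsto.const_mul _ ?_
  have him : i ≤ m := Nat.lt_succ_iff.1 (mem_range.1 hi)
  split_ifs with hh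
  · subst hh
    refine tendsto_const_nhds.congr' ?_
    filter_upwards [eventually_gt_atTop (0 : ℝ)] with x hx
    field_simp
  · exact tendsto_pow_div_pow_atTop_zero (lt_of_le_of_ne him hh)

structure Good (d : ℕ) (c x₀ : ℝ) (F : ℕ → ℝ → ℝ) : Prop where
  der : ∀ j x, x₀ < x → HasDerivAt (F j) (F (j + 1) x) x
  lim : ∀ j ≤ d, ∃ L, 0 < L ∧ Tendsto (fun x => F j x / x ^ (d - j)) atTop (𝓝 L)
  hi : ∀ ε : ℝ, 0 < ε → ∀ j : ℕ, d < j → ∃ A B x₁ : ℝ, 0 < A ∧ 0 < B ∧ 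
      ∀ x : ℝ, x₁ ≤ x → A * x ^ (c - j - ε) ≤ |F j x| ∧ |F j x| ≤ B * x ^ (c - j + ε)

lemma setup (d : ℕ) (hd : 1 ≤ d) (c : ℝ) (hcd : c < d)
    (α : ℕ → ℝ) (hα : 0 < α d)
    (x₀ : ℝ) (hx₀ : 1 ≤ x₀) (r : ℝ → ℝ)
    (hr : ContDiffOn ℝ (⊤ : ℕ∞) r (Set.Ici x₀))
    (hder : ∀ ε : ℝ, 0 < ε → ∀ j : ℕ, ∃ A B x₁ : ℝ, 0 < A ∧ 0 < B ∧ x₀ ≤ x₁ ∧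
      ∀ x : ℝ, x₁ ≤ x →
        A * x ^ (c - j - ε) ≤ |iteratedDerivWithin j r (Set.Ici x₀) x| ∧
        |iteratedDerivWithin j r (Set.Ici x₀) x| ≤ B * x ^ (c - j + ε))
    (f : ℝ → ℝ) (hf : ∀ x : ℝ, f x = (∑ i ∈ Finset.Icc 1 d, α i * x ^ i) + r x) :
    ∃ F, F 0 = f ∧ Good d c x₀ F := by
  set P : Polynomial ℝ := ∑ i ∈ Finset.Icc 1 d, Polynomial.C (α i) * Polynomial.X ^ i with hP
  have hPd : P.natDegree ≤ d := by
    refine Polynomial.natDegree_sum_le_of_forall_le _ _ fun i hi => ?_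
    exact (Polynomial.natDegree_C_mul_X_pow_le _ _).trans (mem_Icc.1 hi).2
  have hPc : P.coeff d = α d := by
    rw [hP, Polynomial.finset_sum_coeff]
    simp only [Polynomial.coeff_C_mul_X_pow]
    rw [sum_ite_eq]
    simp [hd]
  refine ⟨fun j x => (Polynomial.derivative^[j] P).eval x + iteratedDerivWithin j r (Set.Ici x₀) x, ?_, ?_, ?_, ?_⟩
  · funext x
    simp only [Function.iterate_zero, id, iteratedDerivWithin_zero]
    rw [hf x, hP, Polynomial.eval_finset_sum]
    simp
  · intro j x hx
    refine HasDerivAt.add ?_ ?_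
    · rw [Function.iterate_succ_apply']
      exact Polynomial.hasDerivAt _ _
    · have hu : UniqueDiffOn ℝ (Set.Ici x₀) := uniqueDiffOn_Ici x₀
      have hn : Set.Ici x₀ ∈ 𝓝 x := Ici_mem_nhds hx
      have h1 := hr.differentiableOn_iteratedDerivWithin (m := j) (by exact_mod_cast ENat.coe_lt_top j) hu
      have h2 := (h1 x hx.le).hasDerivWithinAt.hasDerivAt hn
      rw [iteratedDerivWithin_succ]
      exact h2
  · intro j hj
    refine ⟨(Polynomial.derivative^[j] P).coeff (d - j), ?_, ?_⟩
    · rw [Polynomial.coeff_iterate_derivative, show d - j + j = d by omega, hPc, nsmul_eq_mul]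
      have : 0 < d.descFactorial j := Nat.descFactorial_pos.2 hj
      positivity
    · have h1 := poly_lim (Polynomial.derivative^[j] P) (d - j)
        ((Polynomial.natDegree_iterate_derivative P j).trans (by omega))
      have h2 : Tendsto (fun x => iteratedDerivWithin j r (Set.Ici x₀) x / x ^ (d - j)) atTop (𝓝 0) := by
        obtain ⟨A, B, x₁, hA, hB, hx₁, H⟩ := hder ((d - c) / 2) (by linarith) j
        have h3 : Tendsto (fun x : ℝ => B * x ^ (-((d - c) / 2))) atTop (𝓝 0) := by
          have := (tendsto_rpow_neg_atTop (y := (d - c) / 2) (by linarith)).const_mul B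
          simpa using this
        refine squeeze_zero_norm' ?_ h3
        filter_upwards [eventually_ge_atTop x₁, eventually_gt_atTop (0 : ℝ)] with x hx hx0
        rw [norm_div, Real.norm_eq_abs, Real.norm_of_nonneg (by positivity), div_le_iff₀ (by positivity)]
        refine ((H x hx).2).trans (le_of_eq ?_)
        rw [mul_assoc, ← Real.rpow_natCast x (d - j), ← Real.rpow_add hx0, Nat.cast_sub hj]
        congr 2; ring
      have := h1.add h2
      simp only [add_zero] at this
      refine this.congr fun x => ?_
      rw [add_div]
  · intro ε hε j hj
    obtain ⟨A, B, x₁, hA, hB, hx₁, H⟩ := hder ε hε j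
    refine ⟨A, B, x₁, hA, hB, fun x hx => ?_⟩
    rw [Polynomial.iterate_derivative_eq_zero (lt_of_le_of_lt hPd hj)]
    simpa using H x hx

lemma lim_bounds {g : ℝ → ℝ} {m : ℕ} {L : ℝ} (hL : 0 < L) (h : Tendsto (fun x => g x / x ^ m) atTop (𝓝 L)) :
    ∀ᶠ x in atTop, L / 2 * x ^ m ≤ g x ∧ g x ≤ 2 * L * x ^ m := by
  filter_upwards [h.eventually (eventually_ge_nhds (by linarith : L / 2 < L)),
    h.eventually (eventually_le_nhds (by linarith : L < 2 * L)), eventually_gt_atTop (0 : ℝ)] with x h1 h2 h3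
  rw [le_div_iff₀ (by positivity)] at h1
  rw [div_le_iff₀ (by positivity)] at h2
  exact ⟨h1, h2⟩

lemma good_hi1 {d : ℕ} {c x₀ : ℝ} {F : ℕ → ℝ → ℝ} (hcd : c < d) (G : Good d c x₀ F) :
    ∃ B, 0 < B ∧ ∀ᶠ x in atTop, |F (d + 1) x| ≤ B / x := by
  obtain ⟨A, B, x₁, hA, hB, H⟩ := G.hi (d - c) (by linarith) (d + 1) (by omega)
  refine ⟨B, hB, ?_⟩
  filter_upwards [eventually_ge_atTop x₁, eventually_gt_atTop (0 : ℝ)] with x hx hx0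
  refine (H x hx).2.trans (le_of_eq ?_)
  rw [div_eq_mul_inv, ← Real.rpow_neg_one]
  congr 2; push_cast; ring

open Finset Filter Topology

noncomputable def SS (F : ℕ → ℝ → ℝ) (X : ℕ) (θ : ℝ) : ℂ := ∑ n ∈ range X, ee (θ * F 0 (X + n))

lemma caseA {d : ℕ} (hd : 1 ≤ d) {c x₀ : ℝ} {F : ℕ → ℝ → ℝ} (hcd : c < d) (G : Good d c x₀ F) :
    ∃ C : ℝ, 0 < C ∧ ∀ᶠ X : ℕ in atTop, ∀ θ : ℝ, 0 < θ → C * (θ * X ^ (d - 1)) ≤ 1 →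
      ‖SS F X θ‖ ≤ C / (θ * X ^ (d - 1)) := by
  obtain ⟨L, hL, h1⟩ := G.lim 1 hd
  have h1 := lim_bounds hL h1
  have h2 : ∃ B, 0 < B ∧ ∀ᶠ x : ℝ in atTop, |F 2 x| ≤ B * x ^ (d - 1) / x := by
    rcases Nat.lt_or_ge 1 d with h | h
    · obtain ⟨L', hL', h2⟩ := G.lim 2 h
      refine ⟨2 * L', by positivity, ?_⟩
      filter_upwards [lim_bounds hL' h2, eventually_gt_atTop (0 : ℝ)] with x hx hx0
      have : 0 ≤ F 2 x := le_trans (by positivity) hx.1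
      rw [abs_of_nonneg this]
      refine hx.2.trans (le_of_eq ?_)
      rw [show d - 1 = d - 2 + 1 by omega, pow_succ]; field_simp
    · obtain rfl : d = 1 := by omega
      obtain ⟨B, hB, h⟩ := good_hi1 hcd G
      refine ⟨B, hB, ?_⟩
      simpa using h
  obtain ⟨B, hB, h2⟩ := h2
  obtain ⟨x₁, hx₁⟩ := eventually_atTop.1 (h1.and h2)
  have hC1 : 0 ≤ 2 / L := by positivity
  have hC2 : 0 ≤ 4 * B * 4 ^ (d - 1) / L ^ 2 := by positivity
  have hC3 : 0 < 4 * L * 4 ^ (d - 1) := by positivity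
  refine ⟨2 / L + 4 * B * 4 ^ (d - 1) / L ^ 2 + 4 * L * 4 ^ (d - 1), by positivity, ?_⟩
  filter_upwards [eventually_ge_atTop 1, tendsto_natCast_atTop_atTop.eventually_ge_atTop x₁,
    tendsto_natCast_atTop_atTop.eventually_gt_atTop x₀] with X hX1 hXx hX0 θ hθ hθX
  have hX1' : (1 : ℝ) ≤ X := by exact_mod_cast hX1
  have hder : ∀ j x, x₀ < x → HasDerivAt ((fun j x => θ * F j x) j) ((fun j x => θ * F j x) (j + 1) x) x :=
    fun j x hx => (G.der j x hx).const_mul θ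
  have bd : ∀ ξ : ℝ, X ≤ ξ → ξ ≤ 4 * X → L / 2 * X ^ (d - 1) ≤ F 1 ξ ∧ F 1 ξ ≤ 2 * L * 4 ^ (d - 1) * X ^ (d - 1)
      ∧ |F 2 ξ| ≤ B * 4 ^ (d - 1) * X ^ (d - 1) / X := by
    intro ξ e1 e2
    have hξ0 : 0 < ξ := by linarith
    obtain ⟨⟨a1, a2⟩, a3⟩ := hx₁ ξ (hXx.trans e1)
    refine ⟨le_trans (by gcongr) a1, a2.trans ?_, a3.trans ?_⟩
    · rw [mul_assoc _ (4 ^ (d - 1) : ℝ), ← mul_pow]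
      gcongr
    · rw [mul_assoc _ (4 ^ (d - 1) : ℝ), ← mul_pow]
      gcongr
  set Z : ℝ := (X : ℝ) ^ (d - 1) with hZ
  have hZ0 : 0 < Z := by positivity
  have kl := kusmin (fun n => θ * F 0 (X + n)) X (θ * (L / 2 * Z)) (θ * (B * 4 ^ (d - 1) * Z / X)) (by positivity)
    (by
      intro n hn
      obtain ⟨ξ, e1, e2, e3⟩ := mvt_dif [1] (fun j x => θ * F j x) x₀ X hX0 hder n
      have hn' : (n : ℝ) ≤ X := by exact_mod_cast hn
      have hn0 : (0 : ℝ) ≤ n := by positivity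
      simp [dif] at e3 e2
      obtain ⟨b1, b2, b3⟩ := bd ξ (by linarith) (by linarith)
      push_cast
      have hF : 0 ≤ F 1 ξ := le_trans (by positivity) b1
      rw [e3, abs_of_nonneg (mul_nonneg hθ.le hF)]
      gcongr)
    (by
      intro n hn
      obtain ⟨ξ, e1, e2, e3⟩ := mvt_dif [1] (fun j x => θ * F j x) x₀ X hX0 hder n
      have hn' : (n : ℝ) ≤ X := by exact_mod_cast hn
      have hn0 : (0 : ℝ) ≤ n := by positivity
      simp [dif] at e3 e2
      obtain ⟨b1, b2, b3⟩ := bd ξ (by linarith) (by linarith)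
      push_cast
      have hF : 0 ≤ F 1 ξ := le_trans (by positivity) b1
      rw [e3, abs_of_nonneg (mul_nonneg hθ.le hF)]
      have : θ * F 1 ξ ≤ θ * (2 * L * 4 ^ (d - 1) * Z) := by gcongr
      have : 0 ≤ (2 / L + 4 * B * 4 ^ (d - 1) / L ^ 2) * (θ * Z) := by positivity
      nlinarith)
    (by
      intro n hn
      obtain ⟨ξ, e1, e2, e3⟩ := mvt_dif [1, 1] (fun j x => θ * F j x) x₀ X hX0 hder n
      have hn' : (n : ℝ) ≤ X := by exact_mod_cast hn
      have hn0 : (0 : ℝ) ≤ n := by positivity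
      simp [dif] at e3 e2
      obtain ⟨b1, b2, b3⟩ := bd ξ (by linarith) (by linarith)
      have e4 : ((n : ℝ) + 1 + 1) = n + 2 := by ring
      rw [e4] at e3
      push_cast
      rw [e3, abs_mul, abs_of_pos hθ]
      gcongr)
  unfold SS
  refine kl.trans ?_
  have : 1 / (θ * (L / 2 * Z)) + X * (θ * (B * 4 ^ (d - 1) * Z / X)) / (θ * (L / 2 * Z)) ^ 2
    = (2 / L + 4 * B * 4 ^ (d - 1) / L ^ 2) / (θ * Z) := by field_simp; ring
  rw [this]
  exact div_le_div_of_nonneg_right (by linarith) (by positivity)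

lemma caseI {d : ℕ} (hd : 1 ≤ d) {c x₀ : ℝ} {F : ℕ → ℝ → ℝ} (hcd : c < d) (G : Good d c x₀ F) :
    ∃ C a E : ℝ, 0 < C ∧ 0 < a ∧ 1 ≤ E ∧ ∀ᶠ X : ℕ in atTop, ∀ (θ : ℝ) (K : ℕ), 0 < θ → 2 ≤ K → E ≤ K →
      θ * a * K ^ d ≤ 1 / 2 → (2 : ℝ) ^ (d - 1) * K ^ (3 * (d - 1) + 2) ≤ X ^ d * (θ * a) →
      (2 : ℝ) ^ d * K ^ (2 * (d - 1) + 3) ≤ X →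
      (‖SS F X θ‖ / X) ^ (2 ^ (d - 1)) ≤ C / K := by
  obtain ⟨L, hL, h1⟩ := G.lim d le_rfl
  have h1 := lim_bounds hL h1
  obtain ⟨B, hB, h2⟩ := good_hi1 hcd G
  obtain ⟨x₁, hx₁⟩ := eventually_atTop.1 (h1.and h2)
  obtain ⟨C, hC, H⟩ := gen' (d - 1)
  refine ⟨C, L / 2, 4 + 2 * B / L, hC, by positivity, by have : 0 < 2 * B / L := by positivity
                                                         linarith, ?_⟩
  filter_upwards [eventually_ge_atTop 1, tendsto_natCast_atTop_atTop.eventually_ge_atTop x₁,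
    tendsto_natCast_atTop_atTop.eventually_gt_atTop x₀] with X hX1 hXx hX0 θ K hθ hK hEK c1 c2 c3
  have hX1' : (1 : ℝ) ≤ X := by exact_mod_cast hX1
  have ed : d - 1 + 1 = d := by omega
  have := H (fun j x => θ * F j x) x₀ (fun j x hx => (G.der j x hx).const_mul θ) X K (θ * (L / 2)) (4 + 2 * B / L)
    hX0 hK (by positivity) (by have : 0 < 2 * B / L := by positivity
                               linarith) hEK
    (by
      intro x hx _
      obtain ⟨⟨a1, a2⟩, a3⟩ := hx₁ x (hXx.trans hx)
      simp only [Nat.sub_self, pow_zero, mul_one] at a1 a2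
      have e2 : d - 1 + 2 = d + 1 := by omega
      rw [ed, e2, abs_mul, abs_mul, abs_of_pos hθ, abs_of_nonneg (by linarith : 0 ≤ F d x)]
      refine ⟨by gcongr, ?_, ?_⟩
      · rw [mul_assoc]
        gcongr
        have : L / 2 * (4 + 2 * B / L) = 2 * L + B := by field_simp; ring
        linarith
      · rw [mul_assoc, mul_div_assoc]
        gcongr
        have : L / 2 * (4 + 2 * B / L) = 2 * L + B := by field_simp; ring
        rw [this]
        refine a3.trans ?_
        gcongr
        linarith)
    (by rw [ed]; exact c1) (by rw [ed]; exact c2) (by rw [ed]; exact c3)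
  exact this

lemma caseII {d : ℕ} {c x₀ : ℝ} {F : ℕ → ℝ → ℝ} (hcd : c < d) (G : Good d c x₀ F)
    (ε : ℝ) (hε : 0 < ε) (hε1 : ε ≤ 1) :
    ∃ C a M : ℝ, 0 < C ∧ 0 < a ∧ 1 ≤ M ∧ ∀ᶠ X : ℕ in atTop, ∀ (θ : ℝ) (K : ℕ), 0 < θ → 2 ≤ K →
      M * (X : ℝ) ^ (2 * ε) ≤ K →
      θ * (a * (X : ℝ) ^ (c - d - 1 - ε)) * K ^ (d + 1) ≤ 1 / 2 →
      (2 : ℝ) ^ d * K ^ (3 * d + 2) ≤ X ^ (d + 1) * (θ * (a * (X : ℝ) ^ (c - d - 1 - ε))) →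
      (2 : ℝ) ^ (d + 1) * K ^ (2 * d + 3) ≤ X →
      (‖SS F X θ‖ / X) ^ (2 ^ d) ≤ C / K := by
  obtain ⟨A, B, x₁, hA, hB, h1⟩ := G.hi ε hε (d + 1) (by omega)
  obtain ⟨A', B', x₂, hA', hB', h2⟩ := G.hi ε hε (d + 2) (by omega)
  obtain ⟨C, hC, H⟩ := gen' d
  set κ : ℝ := ((d : ℝ) + 4) ^ (c - d - 1 - ε) with hκ
  have hκ0 : 0 < κ := by positivity
  have hq0 : 0 < (B + B') / (A * κ) := by positivity
  refine ⟨C, A * κ, (B + B') / (A * κ) + 1, hC, by positivity, by linarith, ?_⟩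
  filter_upwards [eventually_ge_atTop 1, tendsto_natCast_atTop_atTop.eventually_ge_atTop x₁,
    tendsto_natCast_atTop_atTop.eventually_ge_atTop x₂,
    tendsto_natCast_atTop_atTop.eventually_gt_atTop x₀] with X hX1 hXx hXx2 hX0 θ K hθ hK hEK c1 c2 c3
  have hX1' : (1 : ℝ) ≤ X := by exact_mod_cast hX1
  have hXp : (0 : ℝ) < X := by linarith
  have hE : (1 : ℝ) ≤ (X : ℝ) ^ (2 * ε) := Real.one_le_rpow hX1' (by positivity)
  set Y : ℝ := (X : ℝ) ^ (2 * ε) with hY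
  set W : ℝ := (X : ℝ) ^ (c - d - 1 - ε) with hW
  have hW0 : 0 < W := by positivity
  have hWY : W * Y = (X : ℝ) ^ (c - (d + 1 : ℕ) + ε) := by
    rw [hW, hY, ← Real.rpow_add hXp]; congr 1; push_cast; ring
  have hWY2 : W * Y / X = (X : ℝ) ^ (c - (d + 2 : ℕ) + ε) := by
    rw [hW, hY, ← Real.rpow_add hXp, ← Real.rpow_sub_one hXp.ne']; congr 1; push_cast; ring
  have := H (fun j x => θ * F j x) x₀ (fun j x hx => (G.der j x hx).const_mul θ) X K (θ * (A * κ * W))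
    (((B + B') / (A * κ) + 1) * Y)
    hX0 hK (by positivity) (by nlinarith) hEK
    (by
      intro x hx hx4
      have hxp : 0 < x := by linarith
      have a1 := h1 x (hXx.trans hx)
      have a2 := (h2 x (hXx2.trans hx)).2
      have b1 : κ * W ≤ x ^ (c - (d + 1 : ℕ) - ε) := by
        rw [hκ, hW, ← Real.mul_rpow (by positivity) (by positivity)]
        have : c - (d + 1 : ℕ) - ε = c - d - 1 - ε := by push_cast; ring
        rw [this]
        exact Real.rpow_le_rpow_of_nonpos hxp hx4 (by linarith)
      have b2 : x ^ (c - (d + 1 : ℕ) + ε) ≤ W * Y := by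
        rw [hWY]
        exact Real.rpow_le_rpow_of_nonpos hXp hx (by push_cast; linarith)
      have b3 : x ^ (c - (d + 2 : ℕ) + ε) ≤ W * Y / X := by
        rw [hWY2]
        exact Real.rpow_le_rpow_of_nonpos hXp hx (by push_cast; linarith)
      have e : θ * (A * κ * W) * (((B + B') / (A * κ) + 1) * Y) = θ * ((B + B' + A * κ) * (W * Y)) := by
        field_simp
      have hWY0 : 0 < W * Y := by positivity
      rw [e, abs_mul, abs_mul, abs_of_pos hθ]
      refine ⟨?_, ?_, ?_⟩
      · gcongr
        refine le_trans ?_ a1.1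
        rw [mul_assoc]; gcongr
      · gcongr
        refine a1.2.trans ?_
        have : 0 < A * κ := by positivity
        gcongr
        linarith
      · rw [mul_div_assoc]
        gcongr
        refine a2.trans ?_
        rw [mul_div_assoc]
        have : 0 < A * κ := by positivity
        gcongr
        linarith)
    c1 c2 c3
  exact this

lemma ev_rpow (a b C : ℝ) (hab : a < b) : ∀ᶠ X : ℕ in atTop, C * (X : ℝ) ^ a ≤ (X : ℝ) ^ b := by
  have h := (tendsto_rpow_atTop (sub_pos.2 hab)).comp (tendsto_natCast_atTop_atTop (R := ℝ))
  filter_upwards [h.eventually_ge_atTop C, eventually_ge_atTop 1] with X h1 h2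
  have hX : (0 : ℝ) < X := by exact_mod_cast h2
  have : (X : ℝ) ^ b = (X : ℝ) ^ (b - a) * (X : ℝ) ^ a := by rw [← Real.rpow_add hX]; congr 1; ring
  rw [this]
  gcongr
  exact h1

open Finset Filter Topology

lemma evK (σ b C : ℝ) (n : ℕ) (hC : 0 ≤ C) (h : σ * n < b) :
    ∀ᶠ X : ℕ in atTop, C * ((⌊(X : ℝ) ^ σ⌋₊ : ℕ) : ℝ) ^ n ≤ (X : ℝ) ^ b := by
  filter_upwards [ev_rpow (σ * n) b C h] with X h1
  refine le_trans ?_ h1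
  have : ((⌊(X : ℝ) ^ σ⌋₊ : ℕ) : ℝ) ^ n ≤ (X : ℝ) ^ (σ * n) := by
    rw [Real.rpow_mul (by positivity), Real.rpow_natCast]
    gcongr
    exact Nat.floor_le (by positivity)
  gcongr

lemma root_step {d k : ℕ} (hk : k ≤ d) {σ C u X K : ℝ} (hσ : 0 < σ) (hC : 0 < C) (hX : 1 ≤ X) (hK : 0 < K)
    (hKX : X ^ σ ≤ 2 * K) (hu : u ^ (2 ^ k) ≤ C / K) : u ≤ (2 * C + 1) * X ^ (-(σ / 2 ^ d)) := by
  have hXp : 0 < X := by linarith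
  refine le_of_pow_le_pow_left₀ (n := 2 ^ k) (by positivity) (by positivity) (hu.trans ?_)
  have h1 : C / K ≤ 2 * C * X ^ (-σ) := by
    rw [Real.rpow_neg hXp.le, div_le_iff₀ hK, ← div_eq_mul_inv, div_mul_eq_mul_div, le_div_iff₀ (by positivity)]
    nlinarith
  refine h1.trans ?_
  rw [mul_pow]
  have h2 : X ^ (-σ) ≤ (X ^ (-(σ / 2 ^ d))) ^ (2 ^ k) := by
    rw [← Real.rpow_natCast, ← Real.rpow_mul hXp.le]
    apply Real.rpow_le_rpow_of_exponent_le hX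
    push_cast
    have : σ / 2 ^ d * 2 ^ k ≤ σ / 2 ^ d * 2 ^ d := by
      have : (2 : ℝ) ^ k ≤ 2 ^ d := pow_le_pow_right₀ (by norm_num) hk
      gcongr
    have e : σ / 2 ^ d * 2 ^ d = σ := by field_simp
    linarith
  have h3 : 2 * C ≤ (2 * C + 1) ^ (2 ^ k) := by
    have := le_self_pow₀ (by linarith : 1 ≤ 2 * C + 1) (n := 2 ^ k) (by positivity)
    linarith
  gcongr

theorem thmE {d : ℕ} (hd : 1 ≤ d) {c x₀ : ℝ} {F : ℕ → ℝ → ℝ} (hc0 : 0 < c) (hcd : c < d) (G : Good d c x₀ F) :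
    ∃ δ C : ℝ, 0 < δ ∧ 0 < C ∧ ∀ᶠ X : ℕ in atTop, ∀ θ : ℝ, 0 < θ → θ ≤ 1 →
      ‖SS F X θ‖ ≤ C / (θ * X ^ (d - 1)) ∨ ‖SS F X θ‖ ≤ C * (X : ℝ) ^ (1 - δ) := by
  have hdR : (1 : ℝ) ≤ d := by exact_mod_cast hd
  obtain ⟨σ, hσ0, hσc, hσ1⟩ : ∃ σ : ℝ, 0 < σ ∧ σ * (8 * d + 8) ≤ c ∧ σ * (8 * d + 8) ≤ 1 := by
    refine ⟨min c 1 / (8 * d + 8), by positivity, ?_, ?_⟩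
    · rw [div_mul_cancel₀ _ (by positivity)]; exact min_le_left _ _
    · rw [div_mul_cancel₀ _ (by positivity)]; exact min_le_right _ _
  have hσd : 0 < σ * d := by positivity
  obtain ⟨CA, hCA, HA⟩ := caseA hd hcd G
  obtain ⟨CI, a, E, hCI, ha, hE, HI⟩ := caseI hd hcd G
  obtain ⟨CJ, a', M, hCJ, ha', hM, HJ⟩ := caseII hcd G (σ / 4) (by positivity) (by nlinarith)
  have hd1 : ((d - 1 : ℕ) : ℝ) = d - 1 := by rw [Nat.cast_sub hd]; simp
  refine ⟨σ / 2 ^ d, CA + (2 * CI + 1) + (2 * CJ + 1), by positivity, by positivity, ?_⟩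
  filter_upwards [HA, HI, HJ, eventually_ge_atTop 1,
    evK σ 1 (CA / a * 2 ^ (d - 1)) (3 * (d - 1) + 2) (by positivity) (by push_cast; rw [hd1]; nlinarith),
    evK σ 1 (2 ^ d) (2 * (d - 1) + 3) (by positivity) (by push_cast; rw [hd1]; nlinarith),
    ev_rpow 0 σ (2 * E + 4) hσ0,
    ev_rpow (2 * (σ / 4)) σ (2 * M) (by linarith),
    evK σ (-(c - d - 1 - σ / 4)) (2 * a') (d + 1) (by positivity) (by push_cast; nlinarith),
    evK σ (c - σ / 4) (2 ^ d * 2 * a / a') (4 * d + 2) (by positivity) (by push_cast; nlinarith),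
    evK σ 1 (2 ^ (d + 1)) (2 * d + 3) (by positivity) (by push_cast; nlinarith)]
    with X hA hI hJ hX1 k1 k2 k3 k4 k5 k6 k7 θ hθ hθ1
  have hX1' : (1 : ℝ) ≤ X := by exact_mod_cast hX1
  have hXp : (0 : ℝ) < X := by linarith
  have hY1 : (1 : ℝ) ≤ (X : ℝ) ^ σ := Real.one_le_rpow hX1' hσ0.le
  have hKY : (X : ℝ) ^ σ ≤ 2 * (⌊(X : ℝ) ^ σ⌋₊ : ℕ) := by
    have h1 := Nat.lt_floor_add_one ((X : ℝ) ^ σ)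
    have h2 : 1 ≤ ⌊(X : ℝ) ^ σ⌋₊ := Nat.le_floor (by simpa using hY1)
    have h2' : (1 : ℝ) ≤ (⌊(X : ℝ) ^ σ⌋₊ : ℕ) := by exact_mod_cast h2
    exact h1.le.trans (by rw [two_mul]; exact add_le_add le_rfl h2')
  generalize ⌊(X : ℝ) ^ σ⌋₊ = K at *
  simp only [Real.rpow_one, Real.rpow_zero, mul_one] at k1 k2 k3 k7
  have hEK : E ≤ K := by linarith
  have hK2' : (2 : ℝ) ≤ K := by linarith
  have hK2 : 2 ≤ K := by exact_mod_cast hK2'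
  have hKp : (0 : ℝ) < K := by linarith
  have fin : ∀ (k : ℕ) (C : ℝ), k ≤ d → 0 < C → 2 * C + 1 ≤ CA + (2 * CI + 1) + (2 * CJ + 1) →
      (‖SS F X θ‖ / X) ^ (2 ^ k) ≤ C / K →
      ‖SS F X θ‖ ≤ (CA + (2 * CI + 1) + (2 * CJ + 1)) * (X : ℝ) ^ (1 - σ / 2 ^ d) := by
    intro k C hk hC hCC h
    have h1 := root_step hk hσ0 hC hX1' hKp hKY h
    rw [div_le_iff₀ hXp, mul_assoc] at h1
    have e : (X : ℝ) ^ (1 - σ / 2 ^ d) = (X : ℝ) ^ (-(σ / 2 ^ d)) * X := by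
      rw [← Real.rpow_add_one hXp.ne']; congr 1; ring
    rw [e]
    refine h1.trans ?_
    gcongr
  by_cases c1 : (2 : ℝ) ^ (d - 1) * K ^ (3 * (d - 1) + 2) ≤ X ^ d * (θ * a)
  · right
    by_cases c2 : θ * a * K ^ d ≤ 1 / 2
    · exact fin (d - 1) CI (by omega) hCI (by linarith) (hI θ K hθ hK2 hEK c2 c1 k2)
    · push Not at c2
      refine fin d CJ le_rfl hCJ (by linarith) (hJ θ K hθ hK2 ?_ ?_ ?_ k7)
      · linarith
      · rw [Real.rpow_neg hXp.le] at k5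
        set W := (X : ℝ) ^ (c - d - 1 - σ / 4) with hW
        have hW0 : 0 < W := by positivity
        have k5' : 2 * a' * K ^ (d + 1) * W ≤ 1 := by
          have := mul_le_mul_of_nonneg_right k5 hW0.le
          rwa [inv_mul_cancel₀ hW0.ne'] at this
        have : θ * (a' * W * K ^ (d + 1)) ≤ 1 * (a' * W * K ^ (d + 1)) := by gcongr
        nlinarith
      · have e : (X : ℝ) ^ (d + 1) * (θ * (a' * (X : ℝ) ^ (c - d - 1 - σ / 4))) = θ * a' * (X : ℝ) ^ (c - σ / 4) := by
          have : (X : ℝ) ^ (c - σ / 4) = (X : ℝ) ^ (d + 1) * (X : ℝ) ^ (c - d - 1 - σ / 4) := by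
            rw [← Real.rpow_natCast, ← Real.rpow_add hXp]; congr 1; push_cast; ring
          rw [this]; ring
        rw [e]
        calc (2 : ℝ) ^ d * K ^ (3 * d + 2) = 2 ^ d * K ^ (3 * d + 2) * 1 := by ring
          _ ≤ 2 ^ d * K ^ (3 * d + 2) * (2 * (θ * a * K ^ d)) := by gcongr; linarith
          _ = θ * a' * (2 ^ d * 2 * a / a' * K ^ (4 * d + 2)) := by
            field_simp; ring
          _ ≤ _ := by gcongr
  · left
    push Not at c1
    have e : (X : ℝ) ^ d = X ^ (d - 1) * X := by rw [← pow_succ]; congr 1; omega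
    refine (hA θ hθ ?_).trans (div_le_div_of_nonneg_right (by linarith) (by positivity))
    have : CA * (θ * X ^ (d - 1)) * X ≤ 1 * X := by
      rw [one_mul]
      refine le_trans ?_ k1
      rw [mul_assoc (CA / a)]
      have : CA * (θ * X ^ (d - 1)) * X = CA / a * (X ^ d * (θ * a)) := by rw [e]; field_simp
      rw [this]
      gcongr
    exact le_of_mul_le_mul_right this hXp

open Finset Filter Topology


noncomputable def cnt (A : Set ℕ) (n : ℕ) : ℕ := by
  classical exact #{a ∈ Ioc 0 n | a ∈ A}

lemma cnt_eq (A : Set ℕ) [DecidablePred (· ∈ A)] (n : ℕ) : cnt A n = #{a ∈ Ioc 0 n | a ∈ A} := by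
  unfold cnt; congr

lemma cnt_mono {A B : Set ℕ} (h : ∀ a ∈ A, a ∈ B) (n : ℕ) : cnt A n ≤ cnt B n := by
  classical
  unfold cnt
  apply card_le_card
  intro x hx
  simp only [mem_filter] at hx ⊢
  exact ⟨hx.1, h x hx.2⟩

lemma schnir_step {A B C : Set ℕ} (hA : 0 ∈ A) (hB : 0 ∈ B) (hC : ∀ a ∈ A, ∀ b ∈ B, a + b ∈ C)
    (β : ℝ) (hβ : ∀ n : ℕ, β * n ≤ cnt B n) (n : ℕ) :
    (cnt A n : ℝ) + β * (n - cnt A n) ≤ cnt C n := by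
  classical
  induction n using Nat.strong_induction_on with
  | _ n ih =>
  set a := Nat.findGreatest (· ∈ A) n with ha
  have haA : a ∈ A := Nat.findGreatest_spec (P := (· ∈ A)) (Nat.zero_le n) hA
  have han : a ≤ n := Nat.findGreatest_le n
  have hgr : ∀ k, a < k → k ≤ n → k ∉ A := fun k h1 h2 => Nat.findGreatest_is_greatest h1 h2
  rcases Nat.eq_zero_or_pos a with h0 | h0
  · have : cnt A n = 0 := by
      unfold cnt
      rw [card_eq_zero, filter_eq_empty_iff]
      intro k hk
      rw [mem_Ioc] at hk
      exact hgr k (by omega) hk.2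
    rw [this]
    have h2 : cnt B n ≤ cnt C n := cnt_mono (fun b hb => by simpa using hC 0 hA b hb) n
    have h3 : (cnt B n : ℝ) ≤ cnt C n := by exact_mod_cast h2
    have := hβ n
    simp; linarith
  · have hAn : cnt A n = cnt A (a - 1) + 1 := by
      unfold cnt
      rw [← card_insert_of_notMem (a := a)]
      · congr 1
        ext k
        simp only [mem_filter, mem_Ioc, mem_insert]
        constructor
        · rintro ⟨⟨h1, h2⟩, h3⟩
          rcases lt_trichotomy k a with h | h | h
          · right; exact ⟨⟨h1, by omega⟩, h3⟩
          · left; exact h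
          · exact absurd h3 (hgr k h h2)
        · rintro (rfl | ⟨⟨h1, h2⟩, h3⟩)
          · exact ⟨⟨h0, han⟩, haA⟩
          · exact ⟨⟨h1, by omega⟩, h3⟩
      · simp
    have hCn : cnt C (a - 1) + 1 + cnt B (n - a) ≤ cnt C n := by
      unfold cnt
      have e1 : #{b ∈ Ioc 0 (n - a) | b ∈ B} = #(({b ∈ Ioc 0 (n - a) | b ∈ B}).map (addLeftEmbedding a)) := by
        rw [card_map]
      rw [e1, ← card_insert_of_notMem (a := a) (s := {c ∈ Ioc 0 (a - 1) | c ∈ C}) (by simp),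
        ← card_union_of_disjoint]
      · apply card_le_card
        intro k
        simp only [mem_union, mem_insert, mem_filter, mem_Ioc, Finset.mem_map, addLeftEmbedding_apply]
        rintro ((rfl | ⟨⟨h1, h2⟩, h3⟩) | ⟨b, ⟨⟨h1, h2⟩, h3⟩, rfl⟩)
        · exact ⟨⟨h0, han⟩, by simpa using hC _ haA 0 hB⟩
        · exact ⟨⟨h1, by omega⟩, h3⟩
        · exact ⟨⟨by omega, by omega⟩, hC a haA b h3⟩
      · rw [disjoint_left]
        intro k
        simp only [mem_insert, mem_filter, mem_Ioc, Finset.mem_map, addLeftEmbedding_apply]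
        rintro (rfl | ⟨⟨h1, h2⟩, h3⟩) ⟨b, ⟨⟨h1', h2'⟩, h3'⟩, h⟩ <;> omega
    have i1 := ih (a - 1) (by omega)
    have i2 := hβ (n - a)
    have hCn' : (cnt C (a - 1) : ℝ) + 1 + cnt B (n - a) ≤ cnt C n := by exact_mod_cast hCn
    rw [hAn]
    rw [Nat.cast_sub han] at i2
    rw [Nat.cast_sub (show 1 ≤ a from h0)] at i1
    push_cast at i1 ⊢
    nlinarith

open scoped Pointwise in
lemma schnir (P : ℕ → ℕ → Prop) (hadd : ∀ j k m n, P j m → P k n → P (j + k) (m + n)) (h0 : P 1 0)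
    (σ : ℝ) (hσ0 : 0 < σ) (hσ1 : σ ≤ 1) (hσ : ∀ n : ℕ, σ * n ≤ cnt {m | P 1 m} n) : ∃ h, ∀ n, P h n := by
  classical
  have h0k : ∀ k, P (k + 1) 0 := by
    intro k
    induction k with
    | zero => exact h0
    | succ k ih => exact hadd _ _ _ _ ih h0
  have key : ∀ k : ℕ, ∀ n : ℕ, (1 - (1 - σ) ^ (k + 1)) * n ≤ cnt {m | P (k + 1) m} n := by
    intro k
    induction k with
    | zero => intro n; simpa using hσ n
    | succ k ih =>
      intro n
      have h1 := schnir_step (A := {m | P (k + 1) m}) (B := {m | P 1 m}) (C := {m | P (k + 1 + 1) m})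
        (h0k k) h0 (fun a ha b hb => hadd _ _ _ _ ha hb) σ hσ n
      have h2 := ih n
      have h3 := mul_le_mul_of_nonneg_left h2 (sub_nonneg.2 hσ1)
      rw [pow_succ (1 - σ) (k + 1)]
      nlinarith
  obtain ⟨k, hk⟩ := exists_pow_lt_of_lt_one (by norm_num : (0 : ℝ) < 1 / 2) (by linarith : 1 - σ < 1)
  have hk' : (1 - σ) ^ (k + 1) ≤ 1 / 2 := by
    rw [pow_succ]
    have : (1 - σ) ^ k * (1 - σ) ≤ (1 - σ) ^ k * 1 := by
      apply mul_le_mul_of_nonneg_left (by linarith) (pow_nonneg (by linarith) _)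
    linarith
  have hden : 1 / 2 ≤ schnirelmannDensity {m | P (k + 1) m} := by
    rw [le_schnirelmannDensity_iff]
    intro n hn
    rw [← cnt_eq, le_div_iff₀ (by exact_mod_cast hn)]
    refine le_trans ?_ (key k n)
    gcongr
    linarith
  have := add_eq_univ_of_one_le_schirelmannDensity_add_schnirelmannDensity (A := {m | P (k + 1) m})
    (B := {m | P (k + 1) m}) (h0k k) (h0k k) (by linarith)
  refine ⟨(k + 1) + (k + 1), fun n => ?_⟩
  have hn : n ∈ ({m | P (k + 1) m} + {m | P (k + 1) m} : Set ℕ) := by rw [this]; trivial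
  obtain ⟨a, ha, b, hb, rfl⟩ := Set.mem_add.1 hn
  exact hadd _ _ _ _ ha hb

open Finset Filter Topology

lemma norm_sq_sum {ι : Type*} (s : Finset ι) (h : ι → ℝ) :
    (((‖∑ i ∈ s, ee (h i)‖ ^ 2 : ℝ)) : ℂ) = ∑ i ∈ s, ∑ j ∈ s, ee (h i - h j) := by
  push_cast
  rw [← Complex.mul_conj', map_sum, sum_mul_sum]
  simp only [ee_sub]

lemma dbl {Ω : Type*} [Fintype Ω] (g : Ω → ℝ) (L : ℕ) (M : ℝ) :
    ∑ j ∈ range L, ∑ k ∈ range L, ‖∑ p, ee (((j : ℝ) - k) / M * g p)‖ ^ 2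
      = ∑ p, ∑ q, ‖∑ j ∈ range L, ee ((j : ℝ) * (g p - g q) / M)‖ ^ 2 := by
  have : ((∑ j ∈ range L, ∑ k ∈ range L, ‖∑ p, ee (((j : ℝ) - k) / M * g p)‖ ^ 2 : ℝ) : ℂ)
      = ((∑ p, ∑ q, ‖∑ j ∈ range L, ee ((j : ℝ) * (g p - g q) / M)‖ ^ 2 : ℝ) : ℂ) := by
    rw [Complex.ofReal_sum, Complex.ofReal_sum]
    simp only [Complex.ofReal_sum, norm_sq_sum]
    calc _ = ∑ j ∈ range L, ∑ p : Ω, ∑ q : Ω, ∑ k ∈ range L, ee ((j : ℝ) * (g p - g q) / M - (k : ℝ) * (g p - g q) / M) := by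
          refine sum_congr rfl fun j _ => ?_
          rw [sum_comm]
          refine sum_congr rfl fun p _ => ?_
          rw [sum_comm]
          refine sum_congr rfl fun q _ => sum_congr rfl fun k _ => ?_
          congr 1; ring
      _ = _ := by
          rw [sum_comm]
          refine sum_congr rfl fun p _ => ?_
          rw [sum_comm]
  exact_mod_cast this

lemma dir_lower (L : ℕ) (s t : ℝ) (hs : 0 < s) (ht : |t| < s) :
    (L : ℝ) / 2 ≤ ‖∑ j ∈ range L, ee ((j : ℝ) * t / (6 * s * L))‖ := by
  refine le_trans ?_ (Complex.re_le_norm _)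
  rw [Complex.re_sum]
  have : ∀ j ∈ range L, (1 / 2 : ℝ) ≤ (ee ((j : ℝ) * t / (6 * s * L))).re := by
    intro j hj
    rw [ee_re, ← Real.cos_abs, ← Real.cos_pi_div_three]
    have hj' : (j : ℝ) < L := by exact_mod_cast mem_range.1 hj
    have hj0 : (0 : ℝ) ≤ j := by positivity
    have hL : (0 : ℝ) < L := by linarith
    apply Real.cos_le_cos_of_nonneg_of_le_pi (abs_nonneg _) (by linarith [Real.pi_pos])
    rw [abs_mul, abs_of_pos (by positivity : 0 < 2 * Real.pi), abs_div, abs_mul, abs_of_nonneg hj0,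
      abs_of_pos (by positivity : 0 < 6 * s * (L : ℝ))]
    have h1 : (j : ℝ) * |t| ≤ L * s := by gcongr
    have : (j : ℝ) * |t| / (6 * s * L) ≤ 1 / 6 := by
      rw [div_le_iff₀ (by positivity)]; linarith
    nlinarith [Real.pi_pos]
  have := sum_le_sum this
  simp at this
  linarith

lemma sum_dist_le (h : ℕ → ℝ) (h0 : ∀ k, 0 ≤ h k) (L j : ℕ) (hj : j < L) :
    ∑ k ∈ range L, h (j - k + (k - j)) ≤ 2 * ∑ k ∈ range L, h k := by
  rw [← sum_filter_add_sum_filter_not (range L) (· ≤ j), two_mul]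
  apply add_le_add
  · have : ∑ k ∈ range L with k ≤ j, h (j - k + (k - j)) = ∑ i ∈ ({k ∈ range L | k ≤ j}).image (fun k => j - k + (k - j)), h i := by
      rw [sum_image]
      intro a ha b hb hab
      simp at ha hb hab
      omega
    rw [this]
    apply sum_le_sum_of_subset_of_nonneg
    · intro i hi
      simp at hi ⊢
      omega
    · intros; exact h0 _
  · have : ∑ k ∈ range L with ¬ k ≤ j, h (j - k + (k - j)) = ∑ i ∈ ({k ∈ range L | ¬ k ≤ j}).image (fun k => j - k + (k - j)), h i := by
      rw [sum_image]
      intro a ha b hb hab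
      simp at ha hb hab
      omega
    rw [this]
    apply sum_le_sum_of_subset_of_nonneg
    · intro i hi
      simp at hi ⊢
      omega
    · intros; exact h0 _

lemma sum_inv_sq (L : ℕ) : ∑ k ∈ range L, (1 : ℝ) / ((k : ℝ) + 1) ^ 2 ≤ (2 : ℝ) := by
  have : ∀ L : ℕ, ∑ k ∈ range (L + 1), (1 : ℝ) / ((k : ℝ) + 1) ^ 2 ≤ 2 - 1 / ((L : ℝ) + 1) := by
    intro L
    induction L with
    | zero => norm_num
    | succ L ih =>
      rw [sum_range_succ]
      have : (1 : ℝ) / (((L + 1 : ℕ) : ℝ) + 1) ^ 2 ≤ 1 / (L + 1) - 1 / ((L + 1 : ℕ) + 1) := by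
        push_cast
        rw [div_sub_div _ _ (by positivity) (by positivity), div_le_div_iff₀ (by positivity) (by positivity)]
        have : (0 : ℝ) ≤ L := by positivity
        nlinarith
      linarith
  rcases L with _ | L
  · simp
  · refine (this L).trans ?_
    have : (0 : ℝ) ≤ 1 / (L + 1) := by positivity
    linarith

lemma cs_image {Ω : Type*} [Fintype Ω] (v : Ω → ℤ) :
    (Fintype.card Ω) ^ 2 ≤ #(univ.image v) * #{pq : Ω × Ω | v pq.1 = v pq.2} := by
  classical
  have h1 : Fintype.card Ω = ∑ m ∈ univ.image v, #{p : Ω | v p = m} :=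
    card_eq_sum_card_fiberwise (fun p _ => by simp)
  have h2 : #{pq : Ω × Ω | v pq.1 = v pq.2} = ∑ m ∈ univ.image v, (#{p : Ω | v p = m}) ^ 2 := by
    rw [card_eq_sum_card_fiberwise (f := fun pq : Ω × Ω => v pq.1) (t := univ.image v) (fun p _ => by simp)]
    refine sum_congr rfl fun m _ => ?_
    rw [sq, ← card_product]
    congr 1
    ext ⟨p, q⟩
    simp
    constructor
    · rintro ⟨h1, h2⟩; exact ⟨h2, by rw [← h1, h2]⟩
    · rintro ⟨h1, h2⟩; exact ⟨by rw [h1, h2], h1⟩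
  rw [h2, h1]
  exact_mod_cast sq_sum_le_card_mul_sum_sq

lemma SS_pow (F : ℕ → ℝ → ℝ) (X s : ℕ) (θ : ℝ) :
    (SS F X θ) ^ s = ∑ p : Fin s → Fin X, ee (θ * ∑ i, F 0 (X + (p i : ℕ))) := by
  unfold SS
  rw [← Fin.sum_univ_eq_sum_range (fun n => ee (θ * F 0 (X + n))), Fintype.sum_pow]
  refine sum_congr rfl fun p _ => ?_
  have : ∀ t : Finset (Fin s), ∏ i ∈ t, ee (θ * F 0 (X + (p i : ℕ))) = ee (θ * ∑ i ∈ t, F 0 (X + (p i : ℕ))) := by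
    intro t
    classical
    induction t using Finset.induction_on with
    | empty => simp [ee_zero]
    | insert a t ha ih => rw [prod_insert ha, sum_insert ha, mul_add, ee_add, ih]
  exact this univ

lemma SS_neg (F : ℕ → ℝ → ℝ) (X : ℕ) (θ : ℝ) : ‖SS F X (-θ)‖ = ‖SS F X θ‖ := by
  have : SS F X (-θ) = (starRingEnd ℂ) (SS F X θ) := by
    unfold SS
    rw [map_sum]
    refine sum_congr rfl fun n _ => ?_
    rw [ee_conj, neg_mul]
  rw [this, RCLike.norm_conj]

lemma SS_triv (F : ℕ → ℝ → ℝ) (X : ℕ) (θ : ℝ) : ‖SS F X θ‖ ≤ X := by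
  unfold SS
  refine (norm_sum_le _ _).trans ?_
  simp [ee_norm]

open Finset Filter Topology

lemma SS_bd {d : ℕ} (hd : 1 ≤ d) {F : ℕ → ℝ → ℝ} {δ C : ℝ} (hC : 0 < C) {X s : ℕ} (hX : 1 ≤ X) (hs : 1 ≤ s)
    (hsd : (d : ℝ) ≤ 2 * s * δ)
    (hE : ∀ θ : ℝ, 0 < θ → θ ≤ 1 →
      ‖SS F X θ‖ ≤ C / (θ * X ^ (d - 1)) ∨ ‖SS F X θ‖ ≤ C * (X : ℝ) ^ (1 - δ)) (k : ℕ) (hk : k < X ^ d) :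
    ‖SS F X ((k : ℝ) / (6 * s * (X ^ d : ℕ)))‖ ^ (2 * s) ≤
      (X : ℝ) ^ (2 * s) * ((4 * (6 * s * C) ^ (2 * s) + 1) * (1 / ((k : ℝ) + 1) ^ 2) + C ^ (2 * s) / (X ^ d : ℕ)) := by
  have hX' : (1 : ℝ) ≤ X := by exact_mod_cast hX
  have hXp : (0 : ℝ) < X := by linarith
  have hs' : (1 : ℝ) ≤ s := by exact_mod_cast hs
  have hk' : (k : ℝ) < (X : ℝ) ^ d := by exact_mod_cast hk
  push_cast
  have q1 : 0 ≤ 4 * (6 * s * C) ^ (2 * s) := by positivity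
  have q2 : 0 ≤ C ^ (2 * s) / (X : ℝ) ^ d := by positivity
  rcases Nat.eq_zero_or_pos k with rfl | h0
  · have h1 : ‖SS F X (((0 : ℕ) : ℝ) / (6 * s * (X : ℝ) ^ d))‖ ^ (2 * s) ≤ (X : ℝ) ^ (2 * s) :=
      pow_le_pow_left₀ (norm_nonneg _) (SS_triv _ _ _) _
    refine h1.trans (le_mul_of_one_le_right (by positivity) ?_)
    simp
    linarith
  · have hk1 : (1 : ℝ) ≤ k := by exact_mod_cast h0
    have hkp : (0 : ℝ) < k := by linarith
    have eX : (X : ℝ) ^ d = X ^ (d - 1) * X := by rw [← pow_succ]; congr 1; omega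
    rcases hE ((k : ℝ) / (6 * s * (X : ℝ) ^ d)) (by positivity) (by
      rw [div_le_one (by positivity)]; nlinarith) with h | h
    · have e : C / ((k : ℝ) / (6 * s * (X : ℝ) ^ d) * X ^ (d - 1)) = 6 * s * C * X / k := by
        rw [eX]; field_simp
      rw [e] at h
      have h2 := pow_le_pow_left₀ (norm_nonneg _) h (2 * s)
      refine h2.trans ?_
      rw [div_pow, mul_pow]
      have h3 : (6 * s * C) ^ (2 * s) * (X : ℝ) ^ (2 * s) / k ^ (2 * s) ≤
        X ^ (2 * s) * ((4 * (6 * s * C) ^ (2 * s)) * (1 / ((k : ℝ) + 1) ^ 2)) := by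
        have : (1 : ℝ) / k ^ (2 * s) ≤ 4 * (1 / ((k : ℝ) + 1) ^ 2) := by
          have : (k : ℝ) ^ 2 ≤ k ^ (2 * s) := pow_le_pow_right₀ hk1 (by omega)
          rw [mul_one_div, div_le_div_iff₀ (by positivity) (by positivity)]
          nlinarith
        calc _ = (6 * s * C) ^ (2 * s) * (X : ℝ) ^ (2 * s) * (1 / k ^ (2 * s)) := by ring
          _ ≤ (6 * s * C) ^ (2 * s) * (X : ℝ) ^ (2 * s) * (4 * (1 / ((k : ℝ) + 1) ^ 2)) := by gcongr
          _ = _ := by ring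
      refine h3.trans ?_
      gcongr
      have : 0 ≤ 1 / ((k : ℝ) + 1) ^ 2 := by positivity
      nlinarith
    · have h2 := pow_le_pow_left₀ (norm_nonneg _) h (2 * s)
      refine h2.trans ?_
      have h3 : (C * (X : ℝ) ^ (1 - δ)) ^ (2 * s) ≤ X ^ (2 * s) * (C ^ (2 * s) / X ^ d) := by
        rw [mul_pow, mul_div_left_comm]
        gcongr
        rw [← Real.rpow_natCast, ← Real.rpow_mul hXp.le, ← Real.rpow_natCast, ← Real.rpow_natCast, ← Real.rpow_sub hXp]
        apply Real.rpow_le_rpow_of_exponent_le hX'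
        push_cast
        linarith
      refine h3.trans ?_
      gcongr
      have : 0 ≤ (4 * (6 * s * C) ^ (2 * s) + 1) * (1 / ((k : ℝ) + 1) ^ 2) := by positivity
      linarith

lemma count_J {d : ℕ} (hd : 1 ≤ d) {F : ℕ → ℝ → ℝ} {δ C : ℝ} (hC : 0 < C) {X s : ℕ} (hX : 1 ≤ X) (hs : 1 ≤ s)
    (hsd : (d : ℝ) ≤ 2 * s * δ)
    (hE : ∀ θ : ℝ, 0 < θ → θ ≤ 1 →
      ‖SS F X θ‖ ≤ C / (θ * X ^ (d - 1)) ∨ ‖SS F X θ‖ ≤ C * (X : ℝ) ^ (1 - δ)) (g : (Fin s → Fin X) → ℝ)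
    (hg : ∀ p, g p = ∑ i, F 0 (X + (p i : ℕ))) :
    (#{pq : (Fin s → Fin X) × (Fin s → Fin X) | |g pq.1 - g pq.2| < s} : ℝ) * X ^ d ≤
      8 * ((4 * (6 * s * C) ^ (2 * s) + 1) * 2 + C ^ (2 * s)) * (X : ℝ) ^ (2 * s) := by
  have hX' : (1 : ℝ) ≤ X := by exact_mod_cast hX
  have hXp : (0 : ℝ) < X := by linarith
  have hs' : (1 : ℝ) ≤ s := by exact_mod_cast hs
  set D : ℝ := 4 * (6 * s * C) ^ (2 * s) + 1 with hD
  set D' : ℝ := C ^ (2 * s) with hD'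
  set L : ℕ := X ^ d with hL
  have hD0 : 0 ≤ D := by positivity
  have hD0' : 0 ≤ D' := by positivity
  have hLp : (0 : ℝ) < L := by rw [hL]; push_cast; positivity
  set h : ℕ → ℝ := fun k => (X : ℝ) ^ (2 * s) * (D * (1 / ((k : ℝ) + 1) ^ 2) + D' / L) with hh
  have h0 : ∀ k, 0 ≤ h k := fun k => by positivity
  have b1 : ∀ k < L, ‖SS F X ((k : ℝ) / (6 * s * L))‖ ^ (2 * s) ≤ h k :=
    fun k hk => SS_bd hd hC hX hs hsd hE k hk
  have b2 : ∀ j ∈ range L, ∀ k ∈ range L, ‖∑ p, ee (((j : ℝ) - k) / (6 * s * L) * g p)‖ ^ 2 ≤ h (j - k + (k - j)) := by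
    intro j hj k hk
    rw [mem_range] at hj hk
    have e : ∑ p, ee (((j : ℝ) - k) / (6 * s * L) * g p) = SS F X (((j : ℝ) - k) / (6 * s * L)) ^ s := by
      rw [SS_pow]; simp only [hg]
    rw [e, norm_pow, ← pow_mul, mul_comm s 2]
    refine le_trans (le_of_eq ?_) (b1 (j - k + (k - j)) (by omega))
    congr 1
    rcases le_total k j with hkj | hkj
    · rw [Nat.sub_eq_zero_of_le hkj, add_zero, Nat.cast_sub hkj]
    · rw [Nat.sub_eq_zero_of_le hkj, zero_add, Nat.cast_sub hkj, ← SS_neg]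
      congr 2; ring
  have b3 : ∑ j ∈ range L, ∑ k ∈ range L, ‖∑ p, ee (((j : ℝ) - k) / (6 * s * L) * g p)‖ ^ 2
      ≤ L * (2 * ∑ k ∈ range L, h k) := by
    calc _ ≤ ∑ j ∈ range L, (2 * ∑ k ∈ range L, h k) := by
          refine sum_le_sum fun j hj => ?_
          exact (sum_le_sum (b2 j hj)).trans (sum_dist_le h h0 L j (mem_range.1 hj))
      _ = _ := by simp
  have b4 : ∑ k ∈ range L, h k ≤ (X : ℝ) ^ (2 * s) * (D * 2 + D') := by
    simp only [hh]
    rw [← mul_sum, sum_add_distrib, ← mul_sum]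
    have : ∑ k ∈ range L, D' / (L : ℝ) = D' := by simp; field_simp
    rw [this]
    have := sum_inv_sq L
    gcongr
  rw [dbl] at b3
  have b5 : (#{pq : (Fin s → Fin X) × (Fin s → Fin X) | |g pq.1 - g pq.2| < s} : ℝ) * (L / 2) ^ 2 ≤
      ∑ p, ∑ q, ‖∑ j ∈ range L, ee ((j : ℝ) * (g p - g q) / (6 * s * L))‖ ^ 2 := by
    rw [← Fintype.sum_prod_type' (f := fun p q => ‖∑ j ∈ range L, ee ((j : ℝ) * (g p - g q) / (6 * s * L))‖ ^ 2)]
    rw [← nsmul_eq_mul, ← sum_const]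
    refine le_trans (sum_le_sum (g := fun pq : (Fin s → Fin X) × (Fin s → Fin X) =>
      ‖∑ j ∈ range L, ee ((j : ℝ) * (g pq.1 - g pq.2) / (6 * s * L))‖ ^ 2) fun pq hpq => ?_)
      (sum_le_sum_of_subset_of_nonneg (filter_subset _ _) fun _ _ _ => by positivity)
    simp only [mem_filter] at hpq
    exact pow_le_pow_left₀ (by positivity) (dir_lower L s _ (by linarith) hpq.2) 2
  have b6 := b5.trans (b3.trans (mul_le_mul_of_nonneg_left (mul_le_mul_of_nonneg_left b4 (by norm_num)) hLp.le))
  have hLL : (X : ℝ) ^ d = L := by rw [hL]; push_cast; rfl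
  rw [hLL]
  refine le_of_mul_le_mul_right (a := (L : ℝ)) ?_ hLp
  nlinarith

theorem density {d : ℕ} (hd : 1 ≤ d) {c x₀ : ℝ} {F : ℕ → ℝ → ℝ} (hc0 : 0 < c) (hcd : c < d) (G : Good d c x₀ F) :
    ∃ (s : ℕ) (η : ℝ), 1 ≤ s ∧ 0 < η ∧ ∀ᶠ X : ℕ in atTop,
      η * X ^ d ≤ #(univ.image (fun p : Fin s → Fin X => ∑ i, ⌊F 0 (X + (p i : ℕ))⌋)) := by
  obtain ⟨δ, C, hδ, hC, HE⟩ := thmE hd hc0 hcd G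
  obtain ⟨s, hs⟩ := exists_nat_ge (max 1 (d / (2 * δ)))
  have hs1 : (1 : ℝ) ≤ s := (le_max_left _ _).trans hs
  have hs1' : 1 ≤ s := by exact_mod_cast hs1
  have hs2 : (d : ℝ) ≤ 2 * s * δ := by
    have := (le_max_right _ _).trans hs
    rw [div_le_iff₀ (by positivity)] at this
    linarith
  set W : ℝ := 8 * ((4 * (6 * s * C) ^ (2 * s) + 1) * 2 + C ^ (2 * s)) with hW
  have hW0 : 0 < W := by positivity
  refine ⟨s, 1 / W, hs1', by positivity, ?_⟩
  filter_upwards [HE, eventually_ge_atTop 1] with X hE hX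
  have hX' : (1 : ℝ) ≤ X := by exact_mod_cast hX
  have hJ := count_J hd hC hX hs1' hs2 hE (fun p => ∑ i, F 0 (X + (p i : ℕ))) (fun _ => rfl)
  have hcs := cs_image (fun p : Fin s → Fin X => ∑ i, ⌊F 0 (X + (p i : ℕ))⌋)
  have hsub : #{pq : (Fin s → Fin X) × (Fin s → Fin X) |
        ∑ i, ⌊F 0 (X + (pq.1 i : ℕ))⌋ = ∑ i, ⌊F 0 (X + (pq.2 i : ℕ))⌋} ≤
      #{pq : (Fin s → Fin X) × (Fin s → Fin X) |
        |∑ i, F 0 (X + (pq.1 i : ℕ)) - ∑ i, F 0 (X + (pq.2 i : ℕ))| < s} := by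
    apply card_le_card
    intro pq hpq
    simp only [mem_filter, mem_univ, true_and] at hpq ⊢
    have e : ∑ i, F 0 (X + (pq.1 i : ℕ)) - ∑ i, F 0 (X + (pq.2 i : ℕ)) =
        ∑ i, (Int.fract (F 0 (X + (pq.1 i : ℕ))) - Int.fract (F 0 (X + (pq.2 i : ℕ)))) := by
      have : ((∑ i, ⌊F 0 (X + (pq.1 i : ℕ))⌋ : ℤ) : ℝ) = ((∑ i, ⌊F 0 (X + (pq.2 i : ℕ))⌋ : ℤ) : ℝ) := by
        rw [hpq]
      push_cast at this
      simp only [Int.fract, sum_sub_distrib]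
      linarith
    rw [e]
    refine (abs_sum_le_sum_abs _ _).trans_lt ?_
    have : Nonempty (Fin s) := ⟨⟨0, hs1'⟩⟩
    have := sum_lt_sum_of_nonempty (s := (univ : Finset (Fin s))) univ_nonempty
      (f := fun i => |Int.fract (F 0 (X + (pq.1 i : ℕ))) - Int.fract (F 0 (X + (pq.2 i : ℕ)))|) (g := fun _ => (1 : ℝ))
      (fun i _ => by
        rw [abs_lt]
        have := Int.fract_nonneg (F 0 (X + (pq.1 i : ℕ)))
        have := Int.fract_nonneg (F 0 (X + (pq.2 i : ℕ)))
        have := Int.fract_lt_one (F 0 (X + (pq.1 i : ℕ)))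
        have := Int.fract_lt_one (F 0 (X + (pq.2 i : ℕ)))
        constructor <;> linarith)
    simpa using this
  have h1 := hcs.trans (Nat.mul_le_mul_left _ hsub)
  rw [Fintype.card_fun, Fintype.card_fin, Fintype.card_fin, ← pow_mul, mul_comm s 2] at h1
  set V := #(univ.image (fun p : Fin s → Fin X => ∑ i, ⌊F 0 (X + (p i : ℕ))⌋)) with hV
  generalize #{pq : (Fin s → Fin X) × (Fin s → Fin X) |
        |∑ i, F 0 (X + (pq.1 i : ℕ)) - ∑ i, F 0 (X + (pq.2 i : ℕ))| < s} = J at *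
  have h1' : (X : ℝ) ^ (2 * s) ≤ V * J := by exact_mod_cast h1
  have hXs : (0 : ℝ) < (X : ℝ) ^ (2 * s) := by positivity
  have h2 : (X : ℝ) ^ (2 * s) * X ^ d ≤ (V * W) * X ^ (2 * s) := by
    calc (X : ℝ) ^ (2 * s) * X ^ d ≤ V * J * X ^ d := by gcongr
      _ = V * (J * X ^ d) := by ring
      _ ≤ V * (W * X ^ (2 * s)) := by gcongr
      _ = _ := by ring
  have h3 : (X : ℝ) ^ d ≤ V * W := le_of_mul_le_mul_right (by linarith) hXs
  rw [one_div_mul_eq_div, div_le_iff₀ hW0]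
  exact h3

open Finset Filter Topology

def IsSum (f : ℝ → ℝ) (x₀ : ℝ) (t : ℕ) (N : ℤ) : Prop :=
  ∃ n : Fin t → ℕ, (∀ i, x₀ ≤ n i) ∧ ∑ i, ⌊f (n i)⌋ = N

lemma IsSum.add {f : ℝ → ℝ} {x₀ : ℝ} {t t' : ℕ} {N N' : ℤ} (h : IsSum f x₀ t N) (h' : IsSum f x₀ t' N') :
    IsSum f x₀ (t + t') (N + N') := by
  obtain ⟨n, h1, h2⟩ := h
  obtain ⟨n', h1', h2'⟩ := h'
  refine ⟨Fin.append n n', ?_, ?_⟩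
  · intro i
    refine Fin.addCases (fun i => ?_) (fun i => ?_) i
    · simpa using h1 i
    · simpa using h1' i
  · rw [Fin.sum_univ_add]; simp [h2, h2']

lemma IsSum.one {f : ℝ → ℝ} {x₀ : ℝ} {n : ℕ} (hn : x₀ ≤ n) : IsSum f x₀ 1 ⌊f n⌋ :=
  ⟨fun _ => n, fun _ => hn, by simp⟩

lemma equi {d : ℕ} (hd : 1 ≤ d) {c x₀ : ℝ} {F : ℕ → ℝ → ℝ} (hc0 : 0 < c) (hcd : c < d) (G : Good d c x₀ F)
    (θ : ℝ) (hθ : 0 < θ) (hθ1 : θ ≤ 1) : ∀ᶠ X : ℕ in atTop, ‖SS F X θ‖ ≤ X / 4 := by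
  obtain ⟨δ, C, hδ, hC, HE⟩ := thmE hd hc0 hcd G
  filter_upwards [HE, eventually_ge_atTop 1, ev_rpow (1 - δ) 1 (4 * C) (by linarith),
    ev_rpow 0 1 (4 * C / θ) (by norm_num)] with X hE hX h1 h2
  have hX' : (1 : ℝ) ≤ X := by exact_mod_cast hX
  simp only [Real.rpow_one, Real.rpow_zero, mul_one] at h1 h2
  rcases hE θ hθ hθ1 with h | h
  · have : C / (θ * (X : ℝ) ^ (d - 1)) ≤ C / θ := by
      apply div_le_div_of_nonneg_left hC.le hθ
      exact le_mul_of_one_le_right hθ.le (one_le_pow₀ hX')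
    have e : 4 * C / θ = 4 * (C / θ) := by ring
    linarith
  · linarith

lemma no_mod {d : ℕ} (hd : 1 ≤ d) {c x₀ : ℝ} {F : ℕ → ℝ → ℝ} (hc0 : 0 < c) (hcd : c < d) (G : Good d c x₀ F)
    (m a : ℤ) (hm : 2 ≤ m) (h : ∀ n : ℕ, x₀ ≤ n → m ∣ ⌊F 0 n⌋ - a) : False := by
  have hm' : (2 : ℝ) ≤ m := by exact_mod_cast hm
  have hmp : (0 : ℝ) < m := by linarith
  obtain ⟨X, h1, h2, hX0, hX1⟩ := ((equi hd hc0 hcd G (1 / m) (by positivity) (by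
    rw [div_le_one hmp]; linarith)).and ((equi hd hc0 hcd G (2 / m) (by positivity) (by
    rw [div_le_one hmp]; linarith)).and ((tendsto_natCast_atTop_atTop.eventually_ge_atTop x₀).and
      (eventually_ge_atTop 1)))).exists
  have hX1' : (1 : ℝ) ≤ X := by exact_mod_cast hX1
  set y : ℕ → ℝ := fun n => (F 0 (X + n) - a) / m with hy
  have e1 : ∑ n ∈ range X, ee (y n) = SS F X (1 / m) * ee (- (a / m)) := by
    unfold SS
    rw [sum_mul]
    refine sum_congr rfl fun n _ => ?_
    rw [← ee_add]; congr 1; simp only [hy]; ring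
  have e2 : ∑ n ∈ range X, ee (2 * y n) = SS F X (2 / m) * ee (- (2 * a / m)) := by
    unfold SS
    rw [sum_mul]
    refine sum_congr rfl fun n _ => ?_
    rw [← ee_add]; congr 1; simp only [hy]; ring
  have hsin : ∀ n, 0 ≤ Real.sin (2 * Real.pi * y n) := by
    intro n
    obtain ⟨q, hq⟩ := h (X + n) (by push_cast; linarith [(by positivity : (0 : ℝ) ≤ n)])
    push_cast at hq
    have hf := Int.floor_add_fract (F 0 (X + n))
    have f0 := Int.fract_nonneg (F 0 (X + n))
    have f1 := Int.fract_lt_one (F 0 (X + n))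
    have hq' : ((⌊F 0 (X + n)⌋ : ℤ) : ℝ) = m * q + a := by
      have : ⌊F 0 (X + n)⌋ = m * q + a := by linarith
      rw [this]; push_cast; ring
    have ey : 2 * Real.pi * y n = 2 * Real.pi * (Int.fract (F 0 (X + n)) / m) + q * (2 * Real.pi) := by
      simp only [hy]
      rw [← hf, hq']
      have : Int.fract ((m : ℝ) * q + a + Int.fract (F 0 (X + n))) = Int.fract (F 0 (X + n)) := by
        rw [← hq', hf]
      rw [this]
      field_simp
      ring
    rw [ey, Real.sin_add_int_mul_two_pi]
    have g1 : Int.fract (F 0 (X + n)) / m ≤ 1 / 2 := by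
      rw [div_le_div_iff₀ hmp (by norm_num)]; linarith
    have g0 : 0 ≤ Int.fract (F 0 (X + n)) / m := by positivity
    apply Real.sin_nonneg_of_nonneg_of_le_pi
    · have := Real.pi_pos; positivity
    · nlinarith [Real.pi_pos]
  have s1 : ∑ n ∈ range X, Real.sin (2 * Real.pi * y n) ≤ ‖SS F X (1 / m)‖ := by
    have : ∑ n ∈ range X, Real.sin (2 * Real.pi * y n) = (∑ n ∈ range X, ee (y n)).im := by
      rw [Complex.im_sum]; simp only [ee_im]
    rw [this]
    refine (Complex.im_le_norm _).trans ?_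
    rw [e1, norm_mul, ee_norm, mul_one]
  have s2 : ∑ n ∈ range X, Real.cos (2 * Real.pi * (2 * y n)) ≤ ‖SS F X (2 / m)‖ := by
    have : ∑ n ∈ range X, Real.cos (2 * Real.pi * (2 * y n)) = (∑ n ∈ range X, ee (2 * y n)).re := by
      rw [Complex.re_sum]; simp only [ee_re]
    rw [this]
    refine (Complex.re_le_norm _).trans ?_
    rw [e2, norm_mul, ee_norm, mul_one]
  have s3 : ∑ n ∈ range X, (1 - Real.cos (2 * Real.pi * (2 * y n))) ≤ ∑ n ∈ range X, 2 * Real.sin (2 * Real.pi * y n) := by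
    refine sum_le_sum fun n _ => ?_
    have e : 2 * Real.pi * (2 * y n) = 2 * (2 * Real.pi * y n) := by ring
    rw [e, Real.cos_two_mul]
    have := hsin n
    have := Real.sin_le_one (2 * Real.pi * y n)
    have := Real.sin_sq_add_cos_sq (2 * Real.pi * y n)
    nlinarith
  rw [sum_sub_distrib, ← mul_sum] at s3
  simp only [sum_const, card_range, nsmul_eq_mul, mul_one] at s3
  linarith

lemma consec {d : ℕ} (hd : 1 ≤ d) {c x₀ : ℝ} {F : ℕ → ℝ → ℝ} (hc0 : 0 < c) (hcd : c < d) (G : Good d c x₀ F) :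
    ∃ t N, IsSum (F 0) x₀ t N ∧ IsSum (F 0) x₀ t (N + 1) := by
  let H : AddSubgroup ℤ :=
    { carrier := {z | ∃ t N, IsSum (F 0) x₀ t N ∧ IsSum (F 0) x₀ t (N + z)}
      zero_mem' := ⟨0, 0, ⟨fun i => i.elim0, fun i => i.elim0, by simp⟩, ⟨fun i => i.elim0, fun i => i.elim0, by simp⟩⟩
      add_mem' := by
        rintro z z' ⟨t, N, h1, h2⟩ ⟨t', N', h1', h2'⟩
        refine ⟨t + t', N + N', h1.add h1', ?_⟩
        have := h2.add h2'
        rwa [show N + z + (N' + z') = N + N' + (z + z') by ring] at this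
      neg_mem' := by
        rintro z ⟨t, N, h1, h2⟩
        exact ⟨t, N + z, h2, by simpa using h1⟩ }
  obtain ⟨a, ha⟩ := Int.subgroup_cyclic H
  have hmem : ∀ z, z ∈ H ↔ a ∣ z := by
    intro z
    rw [ha, AddSubgroup.mem_closure_singleton]
    constructor
    · rintro ⟨n, rfl⟩; simp
    · rintro ⟨n, rfl⟩; exact ⟨n, by simp [mul_comm]⟩
  by_cases h1 : a ∣ 1
  · exact (hmem 1).2 h1
  exfalso
  set n₀ := ⌈x₀⌉₊
  have hn₀ : x₀ ≤ n₀ := Nat.le_ceil _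
  have hd' : ∀ n : ℕ, x₀ ≤ n → a ∣ ⌊F 0 n⌋ - ⌊F 0 n₀⌋ := by
    intro n hn
    rw [← hmem]
    exact ⟨1, ⌊F 0 n₀⌋, IsSum.one hn₀, by simpa using IsSum.one (f := F 0) hn⟩
  by_cases h0 : a = 0
  · refine no_mod hd hc0 hcd G 2 ⌊F 0 n₀⌋ le_rfl fun n hn => ?_
    have := hd' n hn
    rw [h0, zero_dvd_iff] at this
    rw [this]; exact dvd_zero _
  · refine no_mod hd hc0 hcd G |a| ⌊F 0 n₀⌋ ?_ fun n hn => (abs_dvd _ _).2 (hd' n hn)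
    by_contra hlt
    have h2 : |a| = 1 := by have := abs_pos.2 h0; omega
    exact h1 ((abs_dvd a 1).1 (by rw [h2]))

open Finset Filter Topology

lemma cnt_lower {d : ℕ} (hd : 1 ≤ d) (S : Set ℕ) (h1 : 1 ∈ S) (η : ℝ) (hη : 0 < η) (B X₁ : ℕ) (hB : 1 ≤ B) (hX₁ : 1 ≤ X₁)
    (h : ∀ X : ℕ, X₁ ≤ X → η * X ^ d ≤ cnt S (B * X ^ d)) :
    ∃ σ : ℝ, 0 < σ ∧ σ ≤ 1 ∧ ∀ n : ℕ, σ * n ≤ cnt S n := by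
  classical
  have hB' : (1 : ℝ) ≤ B := by exact_mod_cast hB
  have hn1 : 0 < B * X₁ ^ d := by positivity
  have hn1' : (0 : ℝ) < (B * X₁ ^ d : ℕ) := by exact_mod_cast hn1
  refine ⟨min 1 (min (η / (B * 2 ^ d)) (1 / (B * X₁ ^ d : ℕ))), by positivity, min_le_left _ _, fun n => ?_⟩
  rcases Nat.eq_zero_or_pos n with rfl | hn
  · simp
  rcases Nat.lt_or_ge n (B * X₁ ^ d) with hlt | hge
  · have c1 : 1 ≤ cnt S n := by
      unfold cnt
      rw [Nat.one_le_iff_ne_zero, ← Nat.pos_iff_ne_zero, card_pos]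
      exact ⟨1, by simp; exact ⟨hn, h1⟩⟩
    have c1' : (1 : ℝ) ≤ cnt S n := by exact_mod_cast c1
    refine le_trans ?_ c1'
    have : min 1 (min (η / (B * 2 ^ d)) (1 / (B * X₁ ^ d : ℕ))) ≤ 1 / ((B * X₁ ^ d : ℕ) : ℝ) :=
      (min_le_right _ _).trans (min_le_right _ _)
    calc _ ≤ 1 / ((B * X₁ ^ d : ℕ) : ℝ) * (n : ℝ) := by gcongr
      _ ≤ 1 := by
        rw [one_div_mul_eq_div, div_le_one hn1']
        exact_mod_cast hlt.le
  · set X := Nat.findGreatest (fun X => B * X ^ d ≤ n) n with hX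
    have hXX : X₁ ≤ X := by
      refine Nat.le_findGreatest (P := fun X => B * X ^ d ≤ n) ?_ hge
      calc X₁ ≤ X₁ ^ d := Nat.le_self_pow (by omega) _
        _ ≤ B * X₁ ^ d := Nat.le_mul_of_pos_left _ hB
        _ ≤ n := hge
    have hP : B * X ^ d ≤ n := by
      have := Nat.findGreatest_spec (P := fun X => B * X ^ d ≤ n) (m := 0) (Nat.zero_le n) (by
        rw [zero_pow (by omega)]; simp)
      exact this
    have hgt : n < B * (X + 1) ^ d := by
      by_contra hc
      push Not at hc
      have : X + 1 ≤ n := by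
        calc X + 1 ≤ (X + 1) ^ d := Nat.le_self_pow (by omega) _
        _ ≤ B * (X + 1) ^ d := Nat.le_mul_of_pos_left _ hB
        _ ≤ n := hc
      have h3 := Nat.le_findGreatest (P := fun X => B * X ^ d ≤ n) this hc
      rw [← hX] at h3
      omega
    have hX1 : (1 : ℝ) ≤ X := by exact_mod_cast hX₁.trans hXX
    have hgt' : (n : ℝ) ≤ B * 2 ^ d * X ^ d := by
      have : (n : ℝ) ≤ B * ((X : ℝ) + 1) ^ d := by exact_mod_cast hgt.le
      refine this.trans ?_
      rw [mul_assoc, ← mul_pow]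
      gcongr
      linarith
    have hm : cnt S (B * X ^ d) ≤ cnt S n := by
      unfold cnt
      apply card_le_card
      intro k hk
      simp only [mem_filter, mem_Ioc] at hk ⊢
      exact ⟨⟨hk.1.1, hk.1.2.trans hP⟩, hk.2⟩
    have hm' : (cnt S (B * X ^ d) : ℝ) ≤ cnt S n := by exact_mod_cast hm
    have : min 1 (min (η / (B * 2 ^ d)) (1 / ((B * X₁ ^ d : ℕ) : ℝ))) ≤ η / (B * 2 ^ d) :=
      (min_le_right _ _).trans (min_le_left _ _)
    calc _ ≤ η / (B * 2 ^ d) * (n : ℝ) := by gcongr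
      _ ≤ η / (B * 2 ^ d) * (B * 2 ^ d * X ^ d) := by gcongr
      _ = η * X ^ d := by field_simp
      _ ≤ _ := (h X hXX).trans hm'

theorem main_good {d : ℕ} (hd : 1 ≤ d) {c x₀ : ℝ} {F : ℕ → ℝ → ℝ} (hc0 : 0 < c) (hcd : c < d) (G : Good d c x₀ F) :
    ∃ t : ℕ, ∃ N₀ : ℤ, ∀ N : ℤ, N₀ ≤ N → IsSum (F 0) x₀ t N := by
  classical
  obtain ⟨s, η, hs, hη, hden⟩ := density hd hc0 hcd G
  obtain ⟨t, N, hN, hN1⟩ := consec hd hc0 hcd G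
  obtain ⟨L, hL, hlim⟩ := G.lim 0 (Nat.zero_le _)
  have hlim := lim_bounds hL hlim
  set a : ℤ := ⌊F 0 (⌈x₀⌉₊ : ℕ)⌋ with ha
  have hsa : IsSum (F 0) x₀ s (s * a) := ⟨fun _ => ⌈x₀⌉₊, fun _ => Nat.le_ceil _, by simp [ha]⟩
  set P : ℕ → ℕ → Prop := fun k n => IsSum (F 0) x₀ (k * (s + t)) (n + k * (s * a + N)) with hP
  have hadd : ∀ j k m n, P j m → P k n → P (j + k) (m + n) := by
    intro j k m n h1 h2
    have := IsSum.add h1 h2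
    simp only [hP]
    convert this using 1
    · ring
    · push_cast; ring
  have hP0 : P 1 0 := by
    simp only [hP]
    have := hsa.add hN
    simpa using this
  have hP1 : P 1 1 := by
    simp only [hP]
    have := hsa.add hN1
    convert this using 1
    · ring
    · push_cast; ring
  obtain ⟨x₁, hx₁⟩ := eventually_atTop.1 hlim
  obtain ⟨X₂, hX₂⟩ := eventually_atTop.1 hden
  obtain ⟨B, hB⟩ := exists_nat_ge (s * (2 * L * 2 ^ d) + s * |(a : ℝ)| + 1)
  have hs' : (1 : ℝ) ≤ s := by exact_mod_cast hs
  have hB1 : (1 : ℝ) ≤ B := by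
    have : 0 ≤ s * (2 * L * 2 ^ d) + s * |(a : ℝ)| := by positivity
    linarith
  have hev : ∀ᶠ X : ℕ in atTop, x₁ ≤ X ∧ x₀ ≤ X ∧ X₂ ≤ X ∧ 1 ≤ X ∧ ((a : ℝ) + 1) / (L / 2) ≤ X :=
    (tendsto_natCast_atTop_atTop.eventually_ge_atTop x₁).and
    ((tendsto_natCast_atTop_atTop.eventually_ge_atTop x₀).and
    ((eventually_ge_atTop X₂).and ((eventually_ge_atTop 1).and
      (tendsto_natCast_atTop_atTop.eventually_ge_atTop _))))
  obtain ⟨X₁, hX₁⟩ := eventually_atTop.1 hev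
  obtain ⟨σ, hσ0, hσ1, hσ⟩ := cnt_lower hd {m | P 1 m} hP1 η hη B (max 1 X₁) (by exact_mod_cast hB1) (le_max_left _ _) (by
    intro X hX
    obtain ⟨q1, q2, q3, q4, q5⟩ := hX₁ X ((le_max_right _ _).trans hX)
    refine (hX₂ X q3).trans ?_
    rw [Nat.cast_le]
    have hX1 : (1 : ℝ) ≤ X := by exact_mod_cast q4
    have bnd : ∀ k : Fin X, a + 1 ≤ ⌊F 0 (X + (k : ℕ))⌋ ∧ F 0 (X + (k : ℕ)) ≤ 2 * L * 2 ^ d * X ^ d := by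
      intro k
      have hk : ((k : ℕ) : ℝ) ≤ X := by exact_mod_cast k.2.le
      have hk0 : (0 : ℝ) ≤ ((k : ℕ) : ℝ) := by positivity
      obtain ⟨w1, w2⟩ := hx₁ (X + (k : ℕ)) (by linarith)
      rw [Nat.sub_zero] at w1 w2
      constructor
      · rw [Int.le_floor]
        push_cast
        refine le_trans ?_ w1
        rw [div_le_iff₀ (by positivity)] at q5
        have : (X : ℝ) ≤ ((X : ℝ) + (k : ℕ)) ^ d := by
          calc (X : ℝ) ≤ X + (k : ℕ) := by linarith
            _ ≤ _ := le_self_pow₀ (by linarith) (by omega)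
        nlinarith
      · refine w2.trans ?_
        rw [mul_assoc (2 * L), ← mul_pow]
        gcongr
        linarith
    have vb : ∀ p : Fin s → Fin X, 0 < ∑ i, ⌊F 0 (X + (p i : ℕ))⌋ - s * a ∧
        ∑ i, ⌊F 0 (X + (p i : ℕ))⌋ - s * a ≤ (B * X ^ d : ℕ) := by
      intro p
      constructor
      · have : ∑ i : Fin s, (a + 1) ≤ ∑ i, ⌊F 0 (X + (p i : ℕ))⌋ := sum_le_sum fun i _ => (bnd (p i)).1
        simp only [sum_const, card_univ, Fintype.card_fin, nsmul_eq_mul] at this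
        have : (1 : ℤ) ≤ s := by exact_mod_cast hs
        linarith
      · have h1 : ((∑ i, ⌊F 0 (X + (p i : ℕ))⌋ - s * a : ℤ) : ℝ) ≤ (B : ℝ) * X ^ d := by
          push_cast
          have : ∑ i : Fin s, ((⌊F 0 (X + (p i : ℕ))⌋ : ℤ) : ℝ) ≤ ∑ i : Fin s, (2 * L * 2 ^ d * (X : ℝ) ^ d) :=
            sum_le_sum fun i _ => (Int.floor_le _).trans (bnd (p i)).2
          simp only [sum_const, card_univ, Fintype.card_fin, nsmul_eq_mul] at this
          have h2 : (1 : ℝ) ≤ (X : ℝ) ^ d := one_le_pow₀ hX1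
          have h3 := neg_abs_le (a : ℝ)
          have h4 : (0 : ℝ) ≤ s * |(a : ℝ)| := by positivity
          have h5 : s * |(a : ℝ)| ≤ s * |(a : ℝ)| * X ^ d := le_mul_of_one_le_right h4 h2
          have h6 : (s * (2 * L * 2 ^ d) + s * |(a : ℝ)| + 1) * X ^ d ≤ B * X ^ d := by gcongr
          nlinarith
        exact_mod_cast h1
    have hinj : Set.InjOn (fun v : ℤ => (v - s * a).toNat)
        (univ.image (fun p : Fin s → Fin X => ∑ i, ⌊F 0 (X + (p i : ℕ))⌋) : Finset ℤ) := by
      intro v hv w hw hvw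
      simp only [coe_image, coe_univ, Set.image_univ, Set.mem_range] at hv hw
      obtain ⟨p, rfl⟩ := hv
      obtain ⟨q, rfl⟩ := hw
      have := (vb p).1
      have := (vb q).1
      simp only at hvw
      omega
    rw [← card_image_of_injOn hinj]
    unfold cnt
    apply card_le_card
    intro n hn
    simp only [mem_image, mem_univ, true_and, exists_exists_eq_and] at hn
    obtain ⟨p, rfl⟩ := hn
    obtain ⟨u1, u2⟩ := vb p
    simp only [mem_filter, mem_Ioc, Set.mem_setOf_eq]
    refine ⟨⟨by omega, by omega⟩, ?_⟩
    have hsum : IsSum (F 0) x₀ s (∑ i, ⌊F 0 (X + (p i : ℕ))⌋) :=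
      ⟨fun i => X + p i, fun i => by
        push_cast
        have : (0 : ℝ) ≤ ((p i : ℕ) : ℝ) := by positivity
        linarith, by push_cast; rfl⟩
    have := hsum.add hN
    simp only [hP]
    convert this using 1
    · ring
    · rw [Int.toNat_of_nonneg u1.le]; push_cast; ring)
  obtain ⟨h, hh⟩ := schnir P hadd hP0 σ hσ0 hσ1 hσ
  refine ⟨h * (s + t), h * (s * a + N), fun M hM => ?_⟩
  have := hh (M - h * (s * a + N)).toNat
  simp only [hP] at this
  rwa [Int.toNat_of_nonneg (by linarith), sub_add_cancel] at this

/-- If `f = p + r`, where `p` is a real polynomial of degree `d ≥ 1` with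
positive leading coefficient and zero constant term, and `r` is a
non-polynomial Hardy-field type function of degree `c` with `0 < c < d`,
then the sequence `(⌊f(n)⌋)_{n ≥ x₀}` is an asymptotic basis. -/
theorem stmt_7 (d : ℕ) (hd : 1 ≤ d) (c : ℝ) (hc0 : 0 < c) (hcd : c < d)
    (α : ℕ → ℝ) (hα : 0 < α d)
    (x₀ : ℝ) (hx₀ : 1 ≤ x₀) (r : ℝ → ℝ)
    (hr : ContDiffOn ℝ (⊤ : ℕ∞) r (Set.Ici x₀))
    (hder : ∀ ε : ℝ, 0 < ε → ∀ j : ℕ, ∃ A B x₁ : ℝ, 0 < A ∧ 0 < B ∧ x₀ ≤ x₁ ∧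
      ∀ x : ℝ, x₁ ≤ x →
        A * x ^ (c - j - ε) ≤ |iteratedDerivWithin j r (Set.Ici x₀) x| ∧
        |iteratedDerivWithin j r (Set.Ici x₀) x| ≤ B * x ^ (c - j + ε))
    (f : ℝ → ℝ) (hf : ∀ x : ℝ, f x = (∑ i ∈ Finset.Icc 1 d, α i * x ^ i) + r x) :
    ∃ t : ℕ, ∃ N₀ : ℤ, ∀ N : ℤ, N₀ ≤ N →
      ∃ n : Fin t → ℕ, (∀ i, x₀ ≤ n i) ∧ ∑ i, ⌊f (n i)⌋ = N := by
  obtain ⟨F, rfl, G⟩ := setup d hd c hcd α hα x₀ hx₀ r hr hder f hf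
  exact main_good hd hc0 hcd G
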